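/- arXiv:1812.06209 — 2 statements merged into one kernel-verified Lean document; each statement's English description precedes it below -/
import Mathlib

section
/- Let G be a DAG over observed nodes V and latent nodes L, and let M be the MAG of G over V. For any X, Y ∈ V, if there is a bi-directed path p between X and Y in G, then there is a path p' between X and Y in M whose nodes form a subsequence of the observed nodes of p such that (1) every non-endpoint node of p' is a collider on p', and (2) every directed edge on p' is not visible. -/
open Classical

namespace CG

/-! ### Generic list helpers -/

/-- Consecutive triple on a list. -/
def ListTriple {α : Type} (p : List α) (a b c : α) : Prop :=
  ∃ i : ℕ, p[i]? = some a ∧ p[i+1]? = some b ∧ p[i+2]? = some c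

/-- Consecutive pair (an edge) on a list. -/
def ListEdge {α : Type} (p : List α) (a b : α) : Prop :=
  ∃ i : ℕ, p[i]? = some a ∧ p[i+1]? = some b

/-! ### Mixed graphs (MAGs, PAGs) -/

/-- Edge marks of a mixed graph. -/
inductive Mark : Type
  | tail | arrow | circle
  deriving DecidableEq

/-- A mixed graph over `V`: `mark a b` is the edge mark at `b` on the edge
between `a` and `b` (`none` if there is no edge). -/
structure MixedGraph (V : Type) where
  mark : V → V → Option Mark

namespace MixedGraph

variable {V : Type} (G : MixedGraph V)

def WellFormed : Prop :=
  (∀ a b : V, (G.mark a b).isSome ↔ (G.mark b a).isSome) ∧ ∀ a : V, G.mark a a = none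

def Adj (a b : V) : Prop := (G.mark a b).isSome

/-- Directed edge `a → b`. -/
def DirEdge (a b : V) : Prop := G.mark a b = some Mark.arrow ∧ G.mark b a = some Mark.tail

/-- Bi-directed edge `a ↔ b`. -/
def BiEdge (a b : V) : Prop := G.mark a b = some Mark.arrow ∧ G.mark b a = some Mark.arrow

/-- Edge with circle marks at both ends. -/
def CircleEdge (a b : V) : Prop := G.mark a b = some Mark.circle ∧ G.mark b a = some Mark.circle

def NoCircles : Prop := ∀ a b : V, G.mark a b ≠ some Mark.circle

def StrictAnc : V → V → Prop := Relation.TransGen G.DirEdge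

/-- `a` is an ancestor of `b` (reflexive). -/
def Anc : V → V → Prop := Relation.ReflTransGen G.DirEdge

/-- No directed cycles and no almost-directed cycles. -/
def Ancestral : Prop :=
  (∀ a : V, ¬ G.StrictAnc a a) ∧ ∀ a b : V, G.BiEdge a b → ¬ G.StrictAnc a b

def IsPath (p : List V) : Prop := 2 ≤ p.length ∧ p.Nodup ∧ p.Chain' G.Adj

def IsPathBetween (X Y : V) (p : List V) : Prop :=
  G.IsPath p ∧ p.head? = some X ∧ p.getLast? = some Y

/-- `b` is a collider between `a` and `c` (arrowheads at `b` on both edges). -/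
def Collider (a b c : V) : Prop := G.mark a b = some Mark.arrow ∧ G.mark c b = some Mark.arrow

/-- Every non-endpoint node of `p` is a collider on `p`. -/
def AllColliders (p : List V) : Prop := ∀ a b c : V, ListTriple p a b c → G.Collider a b c

/-- `b` is a definite non-collider between `a` and `c`. -/
def DefNonCollider (a b c : V) : Prop :=
  (G.mark a b = some Mark.tail ∨ G.mark c b = some Mark.tail) ∨
  (G.mark a b = some Mark.circle ∧ G.mark c b = some Mark.circle ∧ ¬ G.Adj a c)

/-- Every non-endpoint node of `p` is a definite collider or definite non-collider. -/
def DefStatusPath (p : List V) : Prop :=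
  ∀ a b c : V, ListTriple p a b c → G.Collider a b c ∨ G.DefNonCollider a b c

/-- The path `p` is into its first node (arrowhead at the first node). -/
def IntoFirst (p : List V) : Prop :=
  ∃ a b : V, p[0]? = some a ∧ p[1]? = some b ∧ G.mark b a = some Mark.arrow

/-- The path `p` is into its last node. -/
def IntoLast (p : List V) : Prop := G.IntoFirst p.reverse

/-- m-connecting path between `X` and `Y` given `Z`. -/
def MConnPath (Z : Set V) (X Y : V) (p : List V) : Prop :=
  G.IsPathBetween X Y p ∧
  ∀ a b c : V, ListTriple p a b c →
    (G.Collider a b c → ∃ z ∈ Z, G.Anc b z) ∧ (¬ G.Collider a b c → b ∉ Z)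

/-- m-separation. -/
def MSep (X Y : V) (Z : Set V) : Prop := ¬ ∃ p : List V, G.MConnPath Z X Y p

/-- Every pair of non-adjacent nodes is m-separated by some set. -/
def Maximal : Prop :=
  ∀ a b : V, a ≠ b → ¬ G.Adj a b → ∃ Z : Set V, a ∉ Z ∧ b ∉ Z ∧ G.MSep a b Z

def IsMAG : Prop := G.WellFormed ∧ G.NoCircles ∧ G.Ancestral ∧ G.Maximal

/-- Markov equivalence: same m-separation relations. -/
def MarkovEq (G₁ G₂ : MixedGraph V) : Prop :=
  ∀ (X Y : V) (Z : Set V), G₁.MSep X Y Z ↔ G₂.MSep X Y Z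

/-- Possibly directed edge step from `a` to `b`: an edge not into `a`. -/
def PossDirStep (a b : V) : Prop := G.Adj a b ∧ G.mark b a ≠ some Mark.arrow

/-- `a` is a possible ancestor of `b`. -/
def PossAnc : V → V → Prop := Relation.ReflTransGen G.PossDirStep

/-- Connected by a circle path (same bucket). -/
def SameBucket : V → V → Prop := Relation.ReflTransGen G.CircleEdge

/-- Bi-directed path in a mixed graph. -/
def BiPath (p : List V) : Prop := 2 ≤ p.length ∧ p.Nodup ∧ p.Chain' G.BiEdge

/-- Induced subgraph over `A` (all nodes kept; edges outside `A` removed). -/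
noncomputable def restrict (A : Set V) : MixedGraph V :=
  ⟨fun a b => if a ∈ A ∧ b ∈ A then G.mark a b else none⟩

end MixedGraph

/-! ### DAGs with latent variables -/

/-- A directed graph over observed nodes `V` and latent nodes `L`. -/
structure LatDAG (V L : Type) where
  edge : V ⊕ L → V ⊕ L → Prop

namespace LatDAG

variable {V L : Type} (D : LatDAG V L)

/-- Acyclic, every latent node is parentless and has exactly two children, both observed. -/
def IsCausalDAG : Prop :=
  (∀ x : V ⊕ L, ¬ Relation.TransGen D.edge x x) ∧
  (∀ (x : V ⊕ L) (l : L), ¬ D.edge x (Sum.inr l)) ∧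
  (∀ l : L, ∃ a b : V, a ≠ b ∧ D.edge (Sum.inr l) (Sum.inl a) ∧ D.edge (Sum.inr l) (Sum.inl b) ∧
    ∀ c : V ⊕ L, D.edge (Sum.inr l) c → c = Sum.inl a ∨ c = Sum.inl b)

def Adj (x y : V ⊕ L) : Prop := D.edge x y ∨ D.edge y x

/-- Ancestor (reflexive). -/
def Anc : V ⊕ L → V ⊕ L → Prop := Relation.ReflTransGen D.edge

def IsPath (p : List (V ⊕ L)) : Prop := 2 ≤ p.length ∧ p.Nodup ∧ p.Chain' D.Adj

def IsPathBetween (x y : V ⊕ L) (p : List (V ⊕ L)) : Prop :=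
  D.IsPath p ∧ p.head? = some x ∧ p.getLast? = some y

/-- The path `p` is into its first node (arrowhead at the first node). -/
def IntoFirst (p : List (V ⊕ L)) : Prop :=
  ∃ a b : V ⊕ L, p[0]? = some a ∧ p[1]? = some b ∧ D.edge b a

def IntoLast (p : List (V ⊕ L)) : Prop := D.IntoFirst p.reverse

/-- Inducing path between observed `X` and `Y` (relative to the latent nodes):
every non-endpoint observed node is a collider on the path and an ancestor of `X` or `Y`. -/
def InducingPath (X Y : V) (p : List (V ⊕ L)) : Prop :=
  D.IsPathBetween (Sum.inl X) (Sum.inl Y) p ∧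
  ∀ a b c : V ⊕ L, ListTriple p a b c → ∀ v : V, b = Sum.inl v →
    (D.edge a b ∧ D.edge c b) ∧ (D.Anc b (Sum.inl X) ∨ D.Anc b (Sum.inl Y))

/-- `a` and `b` are joined by a bi-directed edge, i.e. share a latent parent. -/
def LatentSib (a b : V) : Prop :=
  a ≠ b ∧ ∃ l : L, D.edge (Sum.inr l) (Sum.inl a) ∧ D.edge (Sum.inr l) (Sum.inl b)

/-- Bi-directed path between observed nodes (listing the observed nodes). -/
def BiPath (p : List V) : Prop := 2 ≤ p.length ∧ p.Nodup ∧ p.Chain' D.LatentSib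

/-- Same c-component (reflexive): connected by a bi-directed path. -/
def CConn : V → V → Prop := Relation.ReflTransGen D.LatentSib

/-- Induced subgraph over `A ⊆ V`: keep observed nodes of `A` and the latent nodes
both of whose children are in `A`. -/
def restrict (A : Set V) : LatDAG V L :=
  ⟨fun x y =>
    D.edge x y ∧
    (∀ v : V, x = Sum.inl v → v ∈ A) ∧ (∀ v : V, y = Sum.inl v → v ∈ A) ∧
    (∀ l : L, x = Sum.inr l → ∀ w : V, D.edge (Sum.inr l) (Sum.inl w) → w ∈ A) ∧
    (∀ l : L, y = Sum.inr l → ∀ w : V, D.edge (Sum.inr l) (Sum.inl w) → w ∈ A)⟩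

/-- `F` is a c-forest with root set `R` in `D`. -/
def CForest (F R : Set V) : Prop :=
  R ⊆ F ∧
  (∀ a ∈ F, ∀ b ∈ F, ∀ c ∈ F,
    D.edge (Sum.inl a) (Sum.inl b) → D.edge (Sum.inl a) (Sum.inl c) → b = c) ∧
  R = {a ∈ F | ∀ b ∈ F, ¬ D.edge (Sum.inl a) (Sum.inl b)} ∧
  (∀ a ∈ F, ∀ b ∈ F, Relation.ReflTransGen (fun u w => u ∈ F ∧ w ∈ F ∧ D.LatentSib u w) a b)

end LatDAG

/-- `M` is the MAG of the DAG `D` over the observed nodes. -/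
def IsMAGof {V L : Type} (M : MixedGraph V) (D : LatDAG V L) : Prop :=
  (∀ X Y : V, M.Adj X Y ↔ ∃ p : List (V ⊕ L), D.InducingPath X Y p) ∧
  ∀ X Y : V, M.Adj X Y →
    (M.DirEdge X Y ↔ D.Anc (Sum.inl X) (Sum.inl Y)) ∧
    (M.BiEdge X Y ↔ ¬ D.Anc (Sum.inl X) (Sum.inl Y) ∧ ¬ D.Anc (Sum.inl Y) (Sum.inl X))

/-- The directed edge `A → B` of the MAG `M` is visible: no DAG whose MAG is `M`
has an inducing path between `A` and `B` that is into `A`. -/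
def MagVisible {V : Type} (M : MixedGraph V) (A B : V) : Prop :=
  M.DirEdge A B ∧
  ∀ (L : Type) (D : LatDAG V L), D.IsCausalDAG → IsMAGof M D →
    ¬ ∃ p : List (V ⊕ L), D.InducingPath A B p ∧ D.IntoFirst p

/-- `P` is the PAG of the MAG `M`: same adjacencies, and an arrowhead/tail mark appears
in `P` iff it appears in every Markov equivalent MAG. -/
def IsPAGof {V : Type} (P M : MixedGraph V) : Prop :=
  (∀ a b : V, P.Adj a b ↔ M.Adj a b) ∧
  ∀ a b : V, P.Adj a b →
    ((P.mark a b = some Mark.arrow ↔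
        ∀ M' : MixedGraph V, M'.IsMAG → MixedGraph.MarkovEq M M' →
          M'.mark a b = some Mark.arrow) ∧
     (P.mark a b = some Mark.tail ↔
        ∀ M' : MixedGraph V, M'.IsMAG → MixedGraph.MarkovEq M M' →
          M'.mark a b = some Mark.tail))

/-- The directed edge `A → B` of a PAG `P` is visible: `A → B` in `P` and the edge is
visible in every MAG of the equivalence class represented by `P`. -/
def PagVisible {V : Type} (P : MixedGraph V) (A B : V) : Prop :=
  P.DirEdge A B ∧ ∀ M : MixedGraph V, M.IsMAG → IsPAGof P M → MagVisible M A B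

/-- `X` and `Y` are in the same pc-component of the MAG `M`. -/
def SamePCCompMag {V : Type} (M : MixedGraph V) (X Y : V) : Prop :=
  X = Y ∨ ∃ p : List V, M.IsPathBetween X Y p ∧ M.AllColliders p ∧
    ∀ a b : V, ListEdge p a b → ¬ MagVisible M a b ∧ ¬ MagVisible M b a

/-- `X` and `Y` are in the same pc-component of the PAG `P`. -/
def SamePCCompPag {V : Type} (P : MixedGraph V) (X Y : V) : Prop :=
  X = Y ∨ ∃ p : List V, P.IsPathBetween X Y p ∧ P.AllColliders p ∧
    ∀ a b : V, ListEdge p a b → ¬ PagVisible P a b ∧ ¬ PagVisible P b a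

/-- `D` is a DAG in the Markov equivalence class represented by the PAG `P`. -/
def DagInClass {V L : Type} (P : MixedGraph V) (D : LatDAG V L) : Prop :=
  ∃ M : MixedGraph V, M.IsMAG ∧ IsMAGof M D ∧ IsPAGof P M

/-- `C` is a possible child of `X` in a PAG: they are adjacent, the mark at `X` is not
an arrowhead and the mark at `C` is not a tail. -/
def PossChild {V : Type} (P : MixedGraph V) (X C : V) : Prop :=
  P.Adj X C ∧ P.mark C X ≠ some Mark.arrow ∧ P.mark X C ≠ some Mark.tail

/-- The dc-component of the set `X` in a mixed graph. -/
def DCComp {V : Type} (G : MixedGraph V) (X : Set V) : Set V :=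
  {a | ∃ x ∈ X, Relation.ReflTransGen G.BiEdge x a}

/-- The identification criterion of the theorem: no node `Xi ∈ X` is in the same
pc-component of `P_T` with a possible child `C ∈ T \ X`. -/
def BucketCrit {V : Type} (P : MixedGraph V) (T X : Set V) : Prop :=
  ¬ ∃ Xi ∈ X, ∃ C, C ∈ T ∧ C ∉ X ∧
    PossChild (P.restrict T) Xi C ∧ SamePCCompPag (P.restrict T) Xi C

/-- `B 1 < ... < B m` is a partial topological order over the buckets of `G` covering `T`. -/
def IsBucketTopEnum {V : Type} (G : MixedGraph V) (T : Set V)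
    {m : ℕ} (B : Fin m → Set V) : Prop :=
  (∀ i, (B i).Nonempty) ∧ (∀ i, B i ⊆ T) ∧ (⋃ i, B i) = T ∧
  (∀ i j, i ≠ j → Disjoint (B i) (B j)) ∧
  (∀ i, ∀ a ∈ B i, B i = {b | G.SameBucket a b}) ∧
  (∀ i j, i ≠ j → ∀ a ∈ B i, ∀ b ∈ B j, G.mark a b = some Mark.arrow → i < j)

/-- `B` is a bucket of `G` (with representative in `T`). -/
def IsBucketOf {V : Type} (G : MixedGraph V) (T B : Set V) : Prop :=
  ∃ a ∈ T, B = {b | G.SameBucket a b}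

/-! ### Discrete causal models and c-factors -/

/-- A discrete causal model of a DAG `D`, with observed variables valued in `Ω`. -/
structure CModel {V L : Type} [DecidableEq V] [DecidableEq L]
    (D : LatDAG V L) (Ω : Type) [Fintype Ω] where
  latS : L → Type
  latFin : ∀ l : L, Fintype (latS l)
  latNE : ∀ l : L, Nonempty (latS l)
  cpt : V ⊕ L → (V → Ω) × (∀ l : L, latS l) → ℝ
  cpt_nonneg : ∀ x c, 0 ≤ cpt x c
  cpt_local : ∀ (x : V ⊕ L) (c c' : (V → Ω) × (∀ l : L, latS l)),
    (∀ v : V, (x = Sum.inl v ∨ D.edge (Sum.inl v) x) → c.1 v = c'.1 v) →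
    (∀ l : L, (x = Sum.inr l ∨ D.edge (Sum.inr l) x) → c.2 l = c'.2 l) →
    cpt x c = cpt x c'
  cpt_norm_obs : ∀ (v : V) (c : (V → Ω) × (∀ l : L, latS l)),
    ∑ ω : Ω, cpt (Sum.inl v) (Function.update c.1 v ω, c.2) = 1
  cpt_norm_lat : ∀ (l : L) (c : (V → Ω) × (∀ l : L, latS l)),
    ((@Finset.univ (latS l) (latFin l)).sum
      fun s => cpt (Sum.inr l) (c.1, Function.update c.2 l s)) = 1

/-- The c-factor `Q[T]`, as a function of a full assignment to the observed variables
(the values outside `T` play the role of the intervention values). -/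
noncomputable def CModel.Q {V L : Type} [Fintype V] [DecidableEq V] [Fintype L]
    [DecidableEq L] {D : LatDAG V L} {Ω : Type} [Fintype Ω]
    (M : CModel D Ω) (T : Set V) (c : V → Ω) : ℝ :=
  letI : ∀ l : L, Fintype (M.latS l) := M.latFin
  ∑ g : ∀ l : L, M.latS l,
    (∏ v : V, if v ∈ T then M.cpt (Sum.inl v) (c, g) else 1) *
      ∏ l : L, M.cpt (Sum.inr l) (c, g)

/-- `Q[T \ X]` is identifiable from `Q[T]` in the PAG `P`: a single functional maps
`Q[T]` to `Q[T \ X]` uniformly over every DAG in the class represented by `P`. -/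
def QIdentifiable {V : Type} [Fintype V] [DecidableEq V]
    (P : MixedGraph V) (T X : Set V) : Prop :=
  ∀ (Ω : Type) [Fintype Ω] [Nonempty Ω],
    ∃ F : ((V → Ω) → ℝ) → ((V → Ω) → ℝ),
      ∀ (L : Type) [Fintype L] [DecidableEq L] (D : LatDAG V L),
        D.IsCausalDAG → DagInClass P D →
        ∀ M : CModel D Ω, F (M.Q T) = M.Q (T \ X)

/-- `Q[T \ X]` is identifiable from `Q[T]` in the DAG `D`. -/
def DagIdentifiable {V L : Type} [Fintype V] [DecidableEq V] [Fintype L] [DecidableEq L]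
    (D : LatDAG V L) (T X : Set V) : Prop :=
  ∀ (Ω : Type) [Fintype Ω] [Nonempty Ω],
    ∃ F : ((V → Ω) → ℝ) → ((V → Ω) → ℝ),
      ∀ M : CModel D Ω, F (M.Q T) = M.Q (T \ X)

/-- Probability, under the distribution `q` over the variables of `T` (context fixed
outside `T`), that the variables of `W` take the values given by `c`. -/
noncomputable def MarginProb {V Ω : Type} [Fintype V] [Fintype Ω]
    (T : Set V) (q : (V → Ω) → ℝ) (W : Set V) (c : V → Ω) : ℝ :=
  ∑ d : V → Ω, if (∀ v : V, (v ∈ W ∨ v ∉ T) → d v = c v) then q d else 0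

/-- Conditional term `P_{v\t}(Bi | Prev)` computed from `q = Q[T]`. -/
noncomputable def CondTerm {V Ω : Type} [Fintype V] [Fintype Ω]
    (T : Set V) (q : (V → Ω) → ℝ) (Bi Prev : Set V) (c : V → Ω) : ℝ :=
  MarginProb T q (Bi ∪ Prev) c / MarginProb T q Prev c

/-- Product of the conditional terms of the buckets contained in the dc-component of `X`. -/
noncomputable def BucketDenom {V Ω : Type} [Fintype V] [Fintype Ω]
    (P : MixedGraph V) (T X : Set V) {m : ℕ} (B : Fin m → Set V)
    (q : (V → Ω) → ℝ) (c : V → Ω) : ℝ :=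
  ∏ i ∈ Finset.univ.filter (fun i : Fin m => B i ⊆ DCComp (P.restrict T) X),
    CondTerm T q (B i) {v | ∃ j : Fin m, j < i ∧ v ∈ B j} c

/-- The identification formula: `Q[T\X] = (Q[T] / ∏ P(B_i | B^{(i-1)})) · Σ_x ∏ P(B_i |
B^{(i-1)})`, the product over the buckets of `P_T` inside the dc-component of `X` in a
partial topological order, summed over the values of `X` in the numerator. -/
def BucketFormula {V : Type} [Fintype V] [DecidableEq V]
    (P : MixedGraph V) (T X : Set V) : Prop :=
  ∀ (m : ℕ) (B : Fin m → Set V), IsBucketTopEnum (P.restrict T) T B →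
    ∀ (Ω : Type) [Fintype Ω] [Nonempty Ω] (L : Type) [Fintype L] [DecidableEq L]
      (D : LatDAG V L), D.IsCausalDAG → DagInClass P D →
      ∀ (M : CModel D Ω) (c : V → Ω),
        M.Q (T \ X) c =
          M.Q T c / BucketDenom P T X B (M.Q T) c *
            ∑ d : V → Ω,
              if (∀ v : V, v ∉ X → d v = c v) then BucketDenom P T X B (M.Q T) d else 0

/-- A hedge for `Q[W]` (`W = T \ X`) formed by the intervention set `X`. -/
def IsHedge {V L : Type} (D : LatDAG V L) (W X : Set V) (F F' : Set V) : Prop :=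
  ∃ R : Set V, R ⊆ W ∧ F' ⊆ F ∧ F ⊆ W ∪ X ∧ (F ∩ X).Nonempty ∧ F' ∩ X = ∅ ∧
    D.CForest F R ∧ D.CForest F' R

/-! ### Adjustment, GAC and the IDP algorithm -/

/-- Proper possibly directed path from the set `X` to the set `Y` in a PAG. -/
def ProperPDPath {V : Type} (P : MixedGraph V) (X Y : Set V) (p : List V) : Prop :=
  P.IsPath p ∧ (∃ x ∈ X, p.head? = some x) ∧ (∃ y ∈ Y, p.getLast? = some y) ∧
  (∀ v ∈ p.tail, v ∉ X) ∧ ∀ a b : V, ListEdge p a b → P.mark b a ≠ some Mark.arrow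

/-- `P` is amenable relative to `(X, Y)`: every proper possibly directed path from `X`
to `Y` starts with a visible directed edge out of `X`. -/
def Amenable {V : Type} (P : MixedGraph V) (X Y : Set V) : Prop :=
  ∀ p : List V, ProperPDPath P X Y p →
    ∃ a b : V, p[0]? = some a ∧ p[1]? = some b ∧ PagVisible P a b

/-- The forbidden set: possible descendants of nodes `w ∉ X` lying on proper possibly
directed paths from `X` to `Y`. -/
def Forb {V : Type} (P : MixedGraph V) (X Y : Set V) : Set V :=
  {d | ∃ (w : V) (p : List V), ProperPDPath P X Y p ∧ w ∈ p ∧ w ∉ X ∧ P.PossAnc w d}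

/-- Proper definite status non-causal path from `X` to `Y`. -/
def ProperDefNonCausal {V : Type} (P : MixedGraph V) (X Y : Set V) (p : List V) : Prop :=
  P.IsPath p ∧ P.DefStatusPath p ∧ (∃ x ∈ X, p.head? = some x) ∧
  (∃ y ∈ Y, p.getLast? = some y) ∧ (∀ v ∈ p.tail, v ∉ X) ∧
  ∃ a b : V, ListEdge p a b ∧ P.mark b a = some Mark.arrow

/-- `Z` blocks the definite status path `p`. -/
def BlocksPath {V : Type} (P : MixedGraph V) (Z : Set V) (p : List V) : Prop :=
  (∃ a b c : V, ListTriple p a b c ∧ P.DefNonCollider a b c ∧ b ∈ Z) ∨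
  (∃ a b c : V, ListTriple p a b c ∧ P.Collider a b c ∧ ∀ z ∈ Z, ¬ P.PossAnc b z)

/-- `Z` satisfies the generalized adjustment criterion relative to `(X, Y)` in `P`. -/
def SatGAC {V : Type} (P : MixedGraph V) (X Y Z : Set V) : Prop :=
  Amenable P X Y ∧ Z ∩ Forb P X Y = ∅ ∧
  ∀ p : List V, ProperDefNonCausal P X Y p → BlocksPath P Z p

/-- The canonical adjustment set `Adjust(X, Y, P)`. -/
def AdjustSet {V : Type} (P : MixedGraph V) (X Y : Set V) : Set V :=
  {v | ∃ w ∈ X ∪ Y, P.PossAnc v w} \ (Forb P X Y ∪ X ∪ Y)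

/-- The subroutine `Identify(C, T, Q[T])` of IDP succeeds: it repeatedly removes a
bucket of `P_T` disjoint from `C` satisfying the interventional criterion, until `T = C`. -/
inductive IdentifySucc {V : Type} (P : MixedGraph V) (C : Set V) : Set V → Prop
  | base : IdentifySucc P C C
  | step (T B : Set V) (hBT : B ⊆ T) (hBC : Disjoint B C) (hne : B.Nonempty)
      (hbucket : IsBucketOf (P.restrict T) T B) (hcrit : BucketCrit P T B)
      (h : IdentifySucc P C (T \ B)) : IdentifySucc P C T

/-- The IDP algorithm succeeds on `P_x(y)`: with `D` the set of possible ancestors of `Y`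
in `P_{V \ X}`, every cpc-component of `P_D` is identified by `Identify` from `Q[V]`. -/
def IDPSucc {V : Type} (P : MixedGraph V) (X Y : Set V) : Prop :=
  ∀ a ∈ {d : V | ∃ y ∈ Y, (P.restrict Xᶜ).PossAnc d y},
    IdentifySucc P
      {b : V | b ∈ {d : V | ∃ y ∈ Y, (P.restrict Xᶜ).PossAnc d y} ∧
        Relation.ReflTransGen
          (fun u w =>
            SamePCCompPag (P.restrict {d : V | ∃ y ∈ Y, (P.restrict Xᶜ).PossAnc d y}) u w ∨
            (P.restrict {d : V | ∃ y ∈ Y, (P.restrict Xᶜ).PossAnc d y}).SameBucket u w)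
          a b}
      Set.univ

/-- Definite m-connecting path in a PAG given `Z`. -/
def DefMConnPath {V : Type} (P : MixedGraph V) (Z : Set V) (X Y : V) (p : List V) : Prop :=
  P.IsPathBetween X Y p ∧
  ∀ a b c : V, ListTriple p a b c →
    (P.Collider a b c → ∃ z ∈ Z, P.PossAnc b z) ∧
    (¬ P.Collider a b c → P.DefNonCollider a b c ∧ b ∉ Z)


theorem listTriple_cons {α : Type} {x a b c : α} {p : List α} :
    ListTriple (x :: p) a b c ↔ (x = a ∧ p[0]? = some b ∧ p[1]? = some c) ∨ ListTriple p a b c := by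
  constructor
  · rintro ⟨_ | i, h0, h1, h2⟩
    · exact .inl ⟨by simpa using h0, by simpa using h1, by simpa using h2⟩
    · exact .inr ⟨i, by simpa using h0, by simpa using h1, by simpa using h2⟩
  · rintro (⟨rfl, h1, h2⟩ | ⟨i, h0, h1, h2⟩)
    · exact ⟨0, by simp, by simpa using h1, by simpa using h2⟩
    · exact ⟨i + 1, by simpa using h0, by simpa using h1, by simpa using h2⟩

theorem ListTriple.exists_append {α : Type} {a b c : α} {p : List α} (h : ListTriple p a b c) :
    ∃ l r, p = l ++ a :: b :: c :: r := by
  induction p with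
  | nil => obtain ⟨i, h, -⟩ := h; simp at h
  | cons x p ih =>
    rcases listTriple_cons.1 h with ⟨rfl, hb, hc⟩ | h
    · match p, hb, hc with
      | b' :: c' :: r, hb, hc =>
        simp only [List.getElem?_cons_zero, List.getElem?_cons_succ, Option.some.injEq] at hb hc
        subst hb hc
        exact ⟨[], r, rfl⟩
    · obtain ⟨l, r, rfl⟩ := ih h
      exact ⟨x :: l, r, rfl⟩

theorem ListTriple.of_map {α β : Type} {f : α → β} {q : List α} {a b c : β}
    (h : ListTriple (q.map f) a b c) :
    ∃ i j k, ListTriple q i j k ∧ f i = a ∧ f j = b ∧ f k = c := by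
  obtain ⟨n, h0, h1, h2⟩ := h
  simp only [List.getElem?_map, Option.map_eq_some_iff] at h0 h1 h2
  obtain ⟨i, hi, rfl⟩ := h0
  obtain ⟨j, hj, rfl⟩ := h1
  obtain ⟨k, hk, rfl⟩ := h2
  exact ⟨i, j, k, ⟨n, hi, hj, hk⟩, rfl, rfl, rfl⟩

/-- If middle nodes failing `T` can be bypassed, then any `R`-chain can be thinned to one with the
same endpoints all of whose consecutive triples satisfy `T`. -/
theorem exists_isChain_forall_listTriple {α : Type} {R : α → α → Prop} {T : α → α → α → Prop}
    (bypass : ∀ a b c, R a b → R b c → ¬ T a b c → R a c) (q : List α) (hq : q.IsChain R) :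
    ∃ q' : List α, q'.IsChain R ∧ q'.head? = q.head? ∧ q'.getLast? = q.getLast? ∧
      ∀ a b c, ListTriple q' a b c → T a b c := by
  induction hn : q.length using Nat.strong_induction_on generalizing q with
  | _ n ih =>
    by_cases h : ∀ a b c, ListTriple q a b c → T a b c
    · exact ⟨q, hq, rfl, rfl, h⟩
    push Not at h
    obtain ⟨a, b, c, habc, hT⟩ := h
    obtain ⟨l, r, rfl⟩ := habc.exists_append
    rw [List.isChain_append_cons_cons, List.isChain_cons_cons] at hq
    obtain ⟨hl, hab, hbc, hr⟩ := hq
    obtain ⟨q', h1, h2, h3, h4⟩ := ih (l ++ a :: c :: r).length (by simp at hn ⊢; omega)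
      (l ++ a :: c :: r)
      (List.isChain_append_cons_cons.2 ⟨hl, bypass a b c hab hbc hT, hr⟩) rfl
    refine ⟨q', h1, h2.trans ?_, h3.trans ?_, h4⟩
    · cases l <;> simp
    · simp [List.getLast?_append]

namespace LatDAG

variable {V L : Type} {D : LatDAG V L}

theorem IsCausalDAG.eq_or_eq_of_edge (hD : D.IsCausalDAG) {l : L} {a b v : V} (hab : a ≠ b)
    (ha : D.edge (Sum.inr l) (Sum.inl a)) (hb : D.edge (Sum.inr l) (Sum.inl b))
    (hv : D.edge (Sum.inr l) (Sum.inl v)) : v = a ∨ v = b := by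
  obtain ⟨x, y, -, -, -, h⟩ := hD.2.2 l
  have ha := h _ ha
  have hb := h _ hb
  have hv := h _ hv
  simp only [Sum.inl.injEq] at ha hb hv
  grind

/-- A bi-directed path on the observed nodes, expanded to a path through the latent parents. -/
theorem exists_expansion (hD : D.IsCausalDAG) (a : V) (t : List V)
    (hnd : (a :: t).Nodup) (hch : (a :: t).IsChain D.LatentSib) :
    ∃ w : List (V ⊕ L), (Sum.inl a :: w).IsChain D.Adj ∧ (Sum.inl a :: w).Nodup ∧
      (Sum.inl a :: w).getLast? = (a :: t).getLast?.map Sum.inl ∧ (t ≠ [] → w ≠ []) ∧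
      (∀ y, w[0]? = some y → D.edge y (Sum.inl a)) ∧ (∀ v, Sum.inl v ∈ w → v ∈ t) ∧
      (∀ l v, Sum.inr l ∈ w → D.edge (Sum.inr l) (Sum.inl v) → v ∈ a :: t) ∧
      ∀ x v y, ListTriple (Sum.inl a :: w) x (Sum.inl v) y →
        D.edge x (Sum.inl v) ∧ D.edge y (Sum.inl v) := by
  induction t generalizing a with
  | nil =>
    refine ⟨[], by simp, by simp, by simp, by simp, by simp, by simp, by simp, ?_⟩
    rintro x v y ⟨i, -, h, -⟩
    simp at h
  | cons b t ih =>
    rw [List.isChain_cons_cons] at hch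
    obtain ⟨⟨hab, l, hla, hlb⟩, hch⟩ := hch
    rw [List.nodup_cons] at hnd
    obtain ⟨w, h1, h2, h3, -, h5, h6, h7, h8⟩ := ih b hnd.2 hch
    have hl : Sum.inr l ∉ w := fun h => hnd.1 (h7 l a h hla)
    have ha : Sum.inl a ∉ w := fun h => hnd.1 (List.mem_cons_of_mem _ (h6 a h))
    refine ⟨Sum.inr l :: Sum.inl b :: w, ?_, ?_, ?_, by simp, ?_, ?_, ?_, ?_⟩
    · exact List.isChain_cons_cons.2 ⟨.inr hla, List.isChain_cons_cons.2 ⟨.inl hlb, h1⟩⟩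
    · simp_all
    · simpa [List.getLast?_cons_cons] using h3
    · simpa using hla
    · intro v hv
      simp only [List.mem_cons, reduceCtorEq, Sum.inl.injEq, false_or] at hv
      exact List.mem_cons.2 (hv.imp id (h6 v))
    · intro l' v hl' hv
      simp only [List.mem_cons, Sum.inr.injEq, reduceCtorEq, false_or] at hl'
      rcases hl' with rfl | hl'
      · rcases hD.eq_or_eq_of_edge hab hla hlb hv with rfl | rfl <;> simp
      · exact List.mem_cons_of_mem _ (h7 l' v hl' hv)
    · intro x v y h
      rcases listTriple_cons.1 h with ⟨-, h, -⟩ | h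
      · simp at h
      rcases listTriple_cons.1 h with ⟨rfl, hb, hc⟩ | h
      · simp only [List.getElem?_cons_zero, Option.some.injEq, Sum.inl.injEq] at hb
        subst hb
        exact ⟨hlb, h5 y (by simpa using hc)⟩
      · exact h8 x v y h

/-- A bi-directed path whose nodes are all ancestors of its endpoints is an inducing path into its
first node. -/
theorem exists_inducingPath_intoFirst (hD : D.IsCausalDAG) {a b : V} {s : List V}
    (hs : D.BiPath s) (ha : s.head? = some a) (hb : s.getLast? = some b)
    (hanc : ∀ v ∈ s, D.Anc (Sum.inl v) (Sum.inl a) ∨ D.Anc (Sum.inl v) (Sum.inl b)) :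
    ∃ w : List (V ⊕ L), D.InducingPath a b w ∧ D.IntoFirst w := by
  obtain ⟨hlen, hnd, hch⟩ := hs
  match s, ha with
  | x :: t, ha =>
    obtain rfl : x = a := by simpa using ha
    obtain ⟨w, h1, h2, h3, h4, h5, h6, -, h8⟩ := exists_expansion hD x t hnd hch
    have hw : w ≠ [] := h4 (by rintro rfl; simp at hlen)
    obtain ⟨y, w', rfl⟩ := List.exists_cons_of_ne_nil hw
    refine ⟨_, ⟨⟨⟨by simp, h2, h1⟩, by simp, by rw [h3, hb]; rfl⟩, ?_⟩,
      _, y, rfl, rfl, h5 y rfl⟩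
    rintro u _ z huz v rfl
    refine ⟨h8 u v z huz, hanc v ?_⟩
    obtain ⟨l, r, h⟩ := huz.exists_append
    have hv : (Sum.inl v : V ⊕ L) ∈ Sum.inl x :: y :: w' := by rw [h]; simp
    rcases List.mem_cons.1 hv with hv | hv
    · simp [Sum.inl.inj hv]
    · exact List.mem_cons_of_mem _ (h6 v hv)

theorem LatentSib.symm {a b : V} (h : D.LatentSib a b) : D.LatentSib b a :=
  ⟨h.1.symm, h.2.imp fun _ h => h.symm⟩

theorem BiPath.reverse {s : List V} (hs : D.BiPath s) : D.BiPath s.reverse :=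
  ⟨by simpa using hs.1, List.nodup_reverse.2 hs.2.1,
    List.isChain_reverse.2 (hs.2.2.imp fun _ _ h => h.symm)⟩

/-- The nodes of `p` strictly between positions `i < j` are ancestors of the nodes at `i` or
`j`. -/
def InducingSegment (D : LatDAG V L) (p : List V) (i j : Fin p.length) : Prop :=
  i < j ∧ ∀ k, i < k → k < j →
    D.Anc (Sum.inl p[k]) (Sum.inl p[i]) ∨ D.Anc (Sum.inl p[k]) (Sum.inl p[j])

theorem InducingSegment.trans {p : List V} {i j k : Fin p.length}
    (hij : D.InducingSegment p i j) (hjk : D.InducingSegment p j k)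
    (hj : D.Anc (Sum.inl p[j]) (Sum.inl p[i]) ∨ D.Anc (Sum.inl p[j]) (Sum.inl p[k])) :
    D.InducingSegment p i k := by
  refine ⟨hij.1.trans hjk.1, fun m him hmk => ?_⟩
  rcases lt_trichotomy m j with h | rfl | h
  · rcases hij.2 m him h with h | h
    · exact .inl h
    · exact hj.imp h.trans h.trans
  · exact hj
  · rcases hjk.2 m h hmk with h | h
    · exact hj.imp h.trans h.trans
    · exact .inr h

theorem InducingSegment.exists_biPath {p : List V} (hp : D.BiPath p) {i j : Fin p.length}
    (hij : D.InducingSegment p i j) :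
    ∃ s, D.BiPath s ∧ s.head? = some p[i] ∧ s.getLast? = some p[j] ∧
      ∀ v ∈ s, D.Anc (Sum.inl v) (Sum.inl p[i]) ∨ D.Anc (Sum.inl v) (Sum.inl p[j]) := by
  obtain ⟨i, hi⟩ := i
  obtain ⟨j, hj⟩ := j
  obtain ⟨hlt, h⟩ := hij
  simp only [Fin.mk_lt_mk] at hlt
  have hin : (p.drop i).take (j - i + 1) <:+: p :=
    (List.take_prefix _ _).isInfix.trans (List.drop_suffix _ _).isInfix
  have hlen : ((p.drop i).take (j - i + 1)).length = j - i + 1 := by simp; omega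
  refine ⟨(p.drop i).take (j - i + 1),
    ⟨by omega, hp.2.1.sublist hin.sublist, List.IsChain.infix hp.2.2 hin⟩, ?_, ?_, ?_⟩
  · rw [List.head?_eq_getElem?]
    simp [hi]
  · rw [List.getLast?_eq_getElem?, hlen]
    simp [show i + (j - i) = j by omega, hj]
  · intro v hv
    obtain ⟨m, hm, rfl⟩ := List.getElem_of_mem hv
    rw [hlen] at hm
    simp only [List.getElem_take, List.getElem_drop]
    rcases Nat.eq_zero_or_pos m with rfl | hm0
    · exact .inl .refl
    rcases (show i + m ≤ j by omega).eq_or_lt with hmj | hmj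
    · simp only [hmj]
      exact .inr .refl
    · exact h ⟨i + m, by omega⟩ (by simp [hm0]) (by simpa using hmj)

theorem InducingSegment.exists_inducingPath (hD : D.IsCausalDAG) {p : List V} (hp : D.BiPath p)
    {i j : Fin p.length} (hij : D.InducingSegment p i j) :
    (∃ w, D.InducingPath p[i] p[j] w ∧ D.IntoFirst w) ∧
      ∃ w, D.InducingPath p[j] p[i] w ∧ D.IntoFirst w := by
  obtain ⟨s, hs, hi, hj, h⟩ := hij.exists_biPath hp
  exact ⟨exists_inducingPath_intoFirst hD hs hi hj h,
    exists_inducingPath_intoFirst hD hs.reverse (by simpa using hj) (by simpa using hi)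
      fun v hv => (h v (List.mem_reverse.1 hv)).symm⟩

end LatDAG

theorem IsMAGof.mark_eq_arrow {V L : Type} {M : MixedGraph V} {D : LatDAG V L}
    (h : IsMAGof M D) {a b : V} (hadj : M.Adj a b) (hba : ¬ D.Anc (Sum.inl b) (Sum.inl a)) :
    M.mark a b = some Mark.arrow := by
  by_cases hab : D.Anc (Sum.inl a) (Sum.inl b)
  · exact ((h.2 a b hadj).1.2 hab).1
  · exact ((h.2 a b hadj).2.2 ⟨hab, hba⟩).1

/-- **Lemma dagmag.** A bi-directed path `p` between `X` and `Y` in the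
DAG `G` yields a path `p'` in the MAG `M` over a subsequence of the observed nodes of `p`
on which every non-endpoint node is a collider and no directed edge is visible. -/
theorem dag_to_mag_collider_path {V L : Type} (G : LatDAG V L) (hG : G.IsCausalDAG)
    (M : MixedGraph V) (hM : M.IsMAG) (hMG : IsMAGof M G)
    (X Y : V) (p : List V) (hp : G.BiPath p)
    (hhead : p.head? = some X) (hlast : p.getLast? = some Y) :
    ∃ p' : List V, p'.Sublist p ∧ M.IsPathBetween X Y p' ∧ M.AllColliders p' ∧
      ∀ a b : V, ListEdge p' a b → ¬ MagVisible M a b ∧ ¬ MagVisible M b a := by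
  have key {i j} (hij : G.InducingSegment p i j) := hij.exists_inducingPath hG hp
  have hadj {i j} (hij : G.InducingSegment p i j) : M.Adj p[i] p[j] ∧ M.Adj p[j] p[i] :=
    ⟨(hMG.1 _ _).2 ((key hij).1.imp fun _ h => h.1), (hMG.1 _ _).2 ((key hij).2.imp fun _ h => h.1)⟩
  have hinit : (List.finRange p.length).IsChain (G.InducingSegment p) := by
    rw [List.isChain_iff_getElem]
    intro i hi
    simp only [List.getElem_finRange]
    refine ⟨by simp [Fin.lt_def], fun k h1 h2 => ?_⟩
    simp only [Fin.lt_def, Fin.val_cast] at h1 h2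
    omega
  obtain ⟨q, hch, hqh, hql, hT⟩ := exists_isChain_forall_listTriple
    (T := fun i j k => M.Collider p[i] p[j] p[k])
    (fun i j k hij hjk hT => hij.trans hjk <| by
      by_contra! hj
      exact hT ⟨hMG.mark_eq_arrow (hadj hij).1 hj.1, hMG.mark_eq_arrow (hadj hjk).2 hj.2⟩) _ hinit
  have hlen : 2 ≤ p.length := hp.1
  have hmap : (List.finRange p.length).map (fun i => p[i]) = p := by
    simp
  have hsub : (q.map (fun i => p[i])).Sublist p :=
    List.map_getElem_sublist (List.isChain_iff_pairwise.1 (hch.imp fun _ _ h => h.1))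
  have hh : (q.map (fun i => p[i])).head? = some X := by
    rw [List.head?_map, hqh, ← List.head?_map, hmap, hhead]
  have hl : (q.map (fun i => p[i])).getLast? = some Y := by
    rw [List.getLast?_map, hql, ← List.getLast?_map, hmap, hlast]
  have hXY : X ≠ Y := by
    rintro rfl
    rw [List.head?_eq_getElem?] at hhead
    rw [List.getLast?_eq_getElem?] at hlast
    have := (List.getElem?_inj (by omega) hp.2.1).1 (hhead.trans hlast.symm)
    omega
  refine ⟨q.map (fun i => p[i]), hsub, ⟨⟨?_, hp.2.1.sublist hsub, ?_⟩, hh, hl⟩, ?_, ?_⟩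
  · match q, hh, hl with
    | [i], hh, hl =>
      simp only [List.map_cons, List.map_nil, List.head?_cons, List.getLast?_singleton] at hh hl
      exact absurd (Option.some.inj (hh.symm.trans hl)) hXY
    | _ :: _ :: _, _, _ => simp
  · exact (List.isChain_map _).2 (hch.imp fun _ _ h => (hadj h).1)
  · intro a b c h
    obtain ⟨i, j, k, hijk, rfl, rfl, rfl⟩ := h.of_map
    exact hT i j k hijk
  · rintro a b ⟨n, ha, hb⟩
    simp only [List.getElem?_map, Option.map_eq_some_iff] at ha hb
    obtain ⟨i, hi, rfl⟩ := ha
    obtain ⟨j, hj, rfl⟩ := hb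
    obtain ⟨hn, rfl⟩ := List.getElem?_eq_some_iff.1 hj
    obtain ⟨hn', rfl⟩ := List.getElem?_eq_some_iff.1 hi
    have := key (List.isChain_iff_getElem.1 hch n hn)
    exact ⟨fun h => h.2 L G hG hMG this.1, fun h => h.2 L G hG hMG this.2⟩

end CG
end

section
/- Let M be a MAG over V and P the PAG representing the Markov equivalence class of M. For any X, Y ∈ V, if X and Y are not adjacent in M and there is a collider path p = ⟨X = O_0, ..., O_n = Y⟩ between X and Y in M (every non-endpoint node is a collider on p), and p is the shortest collider path between X and Y over any subsequence of O_1, ..., O_{n-1} in M, then the corresponding path p in P is of definite status (every non-endpoint node is a definite collider or definite non-collider on p in P). -/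
open Classical

namespace CG

namespace MixedGraph

variable {V : Type}

theorem WellFormed.adj_symm {G : MixedGraph V} (h : G.WellFormed) {a b : V} (hab : G.Adj a b) :
    G.Adj b a := (h.1 a b).1 hab

theorem WellFormed.ne_of_adj {G : MixedGraph V} (h : G.WellFormed) {a b : V} (hab : G.Adj a b) :
    a ≠ b := by
  rintro rfl
  simp [Adj, h.2 a] at hab

theorem Collider.symm {G : MixedGraph V} {a b c : V} (h : G.Collider a b c) : G.Collider c b a :=
  ⟨h.2, h.1⟩

theorem DirEdge.adj {G : MixedGraph V} {a b : V} (h : G.DirEdge a b) : G.Adj a b := by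
  simp [Adj, h.1]

theorem dirEdge_of_not_arrow {G : MixedGraph V} (hw : G.WellFormed) (hc : G.NoCircles) {a b : V}
    (hab : G.mark a b = some Mark.arrow) (hba : G.mark b a ≠ some Mark.arrow) :
    G.DirEdge a b := by
  refine ⟨hab, ?_⟩
  have h1 : (G.mark b a).isSome := (hw.1 a b).1 (by simp [hab])
  have h2 := hc b a
  rcases h : G.mark b a with _ | m
  · simp [h] at h1
  · cases m <;> simp_all

/-! ### Active lists -/

/-- Along the list, exactly the colliders lie in `Z`. -/
def ActiveList (G : MixedGraph V) (Z : Set V) : List V → Prop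
  | a :: b :: c :: l => (G.Collider a b c ↔ b ∈ Z) ∧ ActiveList G Z (b :: c :: l)
  | _ => True

variable {G : MixedGraph V} {Z : Set V}

theorem ActiveList.glue {a b c : V} {l' : List V} (h : (G.Collider a b c ↔ b ∈ Z))
    (h' : G.ActiveList Z (b :: c :: l')) :
    ∀ l : List V, G.ActiveList Z (l ++ [a, b]) → G.ActiveList Z (l ++ a :: b :: c :: l')
  | [], _ => ⟨h, h'⟩
  | [_], hl => ⟨hl.1, h, h'⟩
  | _ :: y :: l, hl => by
    have ih := ActiveList.glue h h' (y :: l)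
    cases l with
    | nil => exact ⟨hl.1, ih hl.2⟩
    | cons z l => exact ⟨hl.1, ih hl.2⟩

theorem ActiveList.reverse : ∀ l : List V, G.ActiveList Z l → G.ActiveList Z l.reverse
  | [], _ => trivial
  | [_], _ => trivial
  | [_, _], _ => trivial
  | a :: b :: c :: l, h => by
    have ih := ActiveList.reverse (b :: c :: l) h.2
    have h1 : (G.Collider c b a ↔ b ∈ Z) := by
      rw [← h.1]; exact ⟨Collider.symm, Collider.symm⟩
    have := ActiveList.glue (l' := []) h1 trivial l.reverse (by simpa using ih)
    simpa using this

theorem ActiveList.triple : ∀ l : List V, G.ActiveList Z l → ∀ a b c, ListTriple l a b c →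
    (G.Collider a b c ↔ b ∈ Z)
  | [], _, a, b, c, ⟨i, h, _⟩ => by simp at h
  | [_], _, a, b, c, ⟨i, _, h, _⟩ => by simp at h
  | [_, _], _, a, b, c, ⟨i, _, _, h⟩ => by simp at h
  | x :: y :: z :: l, h, a, b, c, ⟨i, h1, h2, h3⟩ => by
    cases i with
    | zero =>
      simp only [List.getElem?_cons_zero, List.getElem?_cons_succ, Option.some.injEq,
        Nat.zero_add] at h1 h2 h3
      subst h1 h2 h3
      exact h.1
    | succ i => exact ActiveList.triple (y :: z :: l) h.2 a b c ⟨i, h1, h2, h3⟩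

/-- A duplicate-free list of successive neighbours that is active given `Z`. -/
structure ActivePath (G : MixedGraph V) (Z : Set V) (l : List V) : Prop where
  nodup : l.Nodup
  chain : l.IsChain G.Adj
  active : G.ActiveList Z l

theorem ActivePath.reverse (hw : G.WellFormed) {l : List V} (h : G.ActivePath Z l) :
    G.ActivePath Z l.reverse :=
  ⟨List.nodup_reverse.2 h.nodup,
    List.isChain_reverse.2 (h.chain.imp fun _ _ hab => hw.adj_symm hab), h.active.reverse⟩

/-- Attach a path that leaves `x` through a tail to a path that starts at `x`. -/
theorem ActivePath.attach (hw : G.WellFormed) {x : V} {r m : List V}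
    (hr : G.ActivePath Z (x :: r)) (hm : G.ActivePath Z (x :: m))
    (htail : ∀ c ∈ r.head?, x ∉ Z ∧ G.mark c x ≠ some Mark.arrow) (hd : r.Disjoint (x :: m)) :
    G.ActivePath Z (r.reverse ++ x :: m) := by
  have hr' := hr.reverse hw
  refine ⟨?_, ?_, ?_⟩
  · refine List.Nodup.append (List.nodup_reverse.2 (List.nodup_cons.1 hr.nodup).2) hm.nodup ?_
    intro a ha
    exact hd (List.mem_reverse.1 ha)
  · have h1 := hr'.chain
    rw [List.reverse_cons] at h1
    exact List.isChain_split.2 ⟨h1, hm.chain⟩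
  · cases r with
    | nil => simpa using hm.active
    | cons c r =>
      cases m with
      | nil => simpa using hr'.active
      | cons d m =>
        have h2 : (G.Collider c x d ↔ x ∈ Z) := by
          have := htail c (by simp)
          exact ⟨fun h => absurd h.1 this.2, fun h => absurd h this.1⟩
        have := ActiveList.glue h2 hm.active r.reverse (by simpa using hr'.active)
        simpa using this

/-- In a finite set each of whose elements either has a tail towards `e` or a child in the set,
every element starts an active path to `e`. -/
theorem exists_arm (hw : G.WellFormed) (hacyc : ∀ a, ¬ G.StrictAnc a a) {S : Set V}
    (hS : S.Finite) (hSZ : ∀ x ∈ S, x ∉ Z) {e : V} (he : e ∉ S)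
    (hstep : ∀ x ∈ S, (G.Adj x e ∧ G.mark e x ≠ some Mark.arrow) ∨ ∃ y ∈ S, G.DirEdge x y)
    {x : V} (hx : x ∈ S) :
    ∃ r : List V, G.ActivePath Z (x :: r) ∧ (x :: r).getLast? = some e ∧
      (∀ c ∈ r.head?, x ∉ Z ∧ G.mark c x ≠ some Mark.arrow) ∧
      ∀ v ∈ r, v = e ∨ (v ∈ S ∧ G.StrictAnc x v) := by
  have : Finite S := hS
  let R : S → S → Prop := fun a b => G.StrictAnc b a
  have : IsTrans S R := ⟨fun a b c hab hbc => Relation.TransGen.trans hbc hab⟩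
  have : Std.Irrefl R := ⟨fun a h => hacyc a h⟩
  have wf : WellFounded R := Finite.wellFounded_of_trans_of_irrefl R
  suffices H : ∀ x : S, ∃ r : List V, G.ActivePath Z (x :: r) ∧
      ((x : V) :: r).getLast? = some e ∧
      (∀ c ∈ r.head?, (x : V) ∉ Z ∧ G.mark c x ≠ some Mark.arrow) ∧
      ∀ v ∈ r, v = e ∨ (v ∈ S ∧ G.StrictAnc x v) from H ⟨x, hx⟩
  intro x
  induction x using wf.induction with
  | _ x ih =>
    obtain ⟨x, hx⟩ := x
    rcases hstep x hx with ⟨hadj, hne⟩ | ⟨y, hy, hxy⟩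
    · refine ⟨[e], ⟨?_, ?_, trivial⟩, by simp, ?_, by simp⟩
      · simpa using hw.ne_of_adj hadj
      · simpa using hadj
      · simpa using ⟨hSZ x hx, hne⟩
    · obtain ⟨r, hr, hlast, htail, hmem⟩ := ih ⟨y, hy⟩ (Relation.TransGen.single hxy)
      have hmem' : ∀ v ∈ y :: r, v = e ∨ (v ∈ S ∧ G.StrictAnc x v) := by
        intro v hv
        rcases List.mem_cons.1 hv with rfl | hv
        · exact Or.inr ⟨hy, Relation.TransGen.single hxy⟩
        · exact (hmem v hv).imp id fun h => ⟨h.1, Relation.TransGen.head hxy h.2⟩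
      refine ⟨y :: r, ⟨?_, ?_, ?_⟩, ?_, ?_, hmem'⟩
      · refine List.nodup_cons.2 ⟨fun hxr => ?_, hr.nodup⟩
        rcases hmem' x hxr with rfl | h
        · exact he hx
        · exact hacyc x h.2
      · exact List.isChain_cons_cons.2 ⟨hxy.adj, hr.chain⟩
      · cases r with
        | nil => trivial
        | cons c r =>
          have := htail c (by simp)
          exact ⟨⟨fun h => absurd h.2 this.2, fun h => absurd h this.1⟩, hr.active⟩
      · rw [List.getLast?_cons_cons]; exact hlast
      · simp only [List.head?_cons, Option.mem_def, Option.some.injEq, forall_eq']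
        exact ⟨hSZ x hx, by rw [hxy.2]; simp⟩

/-! ### Indexed sequences of vertices -/

theorem activePath_segment {f : ℕ → V} {n : ℕ} (hinj : Set.InjOn f (Set.Iic n))
    (hadj : ∀ i < n, G.Adj (f i) (f (i + 1))) (d : ℕ) :
    ∀ x, x + d ≤ n →
      (∀ j, x < j → j < x + d → (G.Collider (f (j - 1)) (f j) (f (j + 1)) ↔ f j ∈ Z)) →
      G.ActivePath Z ((List.range' x (d + 1)).map f) := by
  induction d with
  | zero => intro x _ _; exact ⟨by simp, by simp, trivial⟩
  | succ d ih =>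
    intro x hx hact
    have h := ih (x + 1) (by omega) fun j h1 h2 => hact j (by omega) (by omega)
    have hcons : (List.range' x (d + 1 + 1)).map f
        = f x :: (List.range' (x + 1) (d + 1)).map f := by
      rw [List.range'_succ]; simp
    have hcons' : (List.range' (x + 1) (d + 1)).map f
        = f (x + 1) :: (List.range' (x + 1 + 1) d).map f := by
      rw [List.range'_succ]; simp
    rw [hcons]
    refine ⟨?_, ?_, ?_⟩
    · refine List.nodup_cons.2 ⟨fun hm => ?_, h.nodup⟩
      obtain ⟨j, hj, hjx⟩ := List.mem_map.1 hm
      rw [List.mem_range'_1] at hj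
      have := hinj (Set.mem_Iic.2 (by omega)) (Set.mem_Iic.2 (by omega)) hjx
      omega
    · have := h.chain
      rw [hcons'] at this ⊢
      exact List.isChain_cons_cons.2 ⟨hadj x (by omega), this⟩
    · have := h.active
      rw [hcons'] at this ⊢
      cases d with
      | zero => trivial
      | succ d =>
        rw [List.range'_succ] at this ⊢
        exact ⟨by simpa using hact (x + 1) (by omega) (by omega), this⟩

set_option maxHeartbeats 1000000 in
/-- If every vertex of a sequence is active or else leads through tails towards an end of the
sequence along a marked set of vertices outside `Z`, then the ends are connected given `Z`. -/
theorem exists_activePath (hw : G.WellFormed) (hacyc : ∀ a, ¬ G.StrictAnc a a) {f : ℕ → V} {n : ℕ}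
    (hn : 0 < n) (hinj : Set.InjOn f (Set.Iic n)) (hadj : ∀ i < n, G.Adj (f i) (f (i + 1)))
    {T : Set ℕ} (hT : ∀ i ∈ T, 0 < i ∧ i < n ∧ f i ∉ Z ∧
      ((G.Adj (f i) (f 0) ∧ G.mark (f 0) (f i) ≠ some Mark.arrow) ∨
        (G.Adj (f i) (f n) ∧ G.mark (f n) (f i) ≠ some Mark.arrow) ∨
        ∃ j ∈ T, G.DirEdge (f i) (f j)))
    (hact : ∀ i, 0 < i → i < n → i ∉ T →
      (G.Collider (f (i - 1)) (f i) (f (i + 1)) ↔ f i ∈ Z)) :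
    ∃ q, G.ActivePath Z q ∧ q.head? = some (f 0) ∧ q.getLast? = some (f n) := by
  have hinj' : ∀ i j, i ≤ n → j ≤ n → f i = f j → i = j := fun i j hi hj h =>
    hinj (Set.mem_Iic.2 hi) (Set.mem_Iic.2 hj) h
  have hfin : (f '' T).Finite :=
    ((Set.finite_Iio n).subset fun i hi => Set.mem_Iio.2 (hT i hi).2.1).image f
  let E : V → Prop := fun v => ∃ u, Relation.ReflTransGen
    (fun a b => G.DirEdge a b ∧ b ∈ f '' T) v u ∧ G.Adj u (f 0) ∧
      G.mark (f 0) u ≠ some Mark.arrow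
  have hzero : 0 ∉ T := fun h => absurd (hT 0 h).1 (lt_irrefl 0)
  have hnT : n ∉ T := fun h => absurd (hT n h).2.1 (lt_irrefl n)
  have hleft : ∀ x ∈ T, E (f x) → ∃ r : List V, G.ActivePath Z (f x :: r) ∧
      (f x :: r).getLast? = some (f 0) ∧
      (∀ c ∈ r.head?, f x ∉ Z ∧ G.mark c (f x) ≠ some Mark.arrow) ∧
      ∀ v ∈ r, v = f 0 ∨ (v ∈ {v ∈ f '' T | E v} ∧ G.StrictAnc (f x) v) := by
    intro x hx hE
    refine exists_arm hw hacyc (hfin.subset fun v hv => hv.1) ?_ ?_ ?_ ⟨⟨x, hx, rfl⟩, hE⟩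
    · rintro _ ⟨⟨i, hi, rfl⟩, -⟩
      exact (hT i hi).2.2.1
    · rintro ⟨⟨i, hi, h⟩, -⟩
      have := hinj' i 0 (hT i hi).2.1.le (Nat.zero_le n) h
      exact hzero (this ▸ hi)
    · rintro v ⟨-, u, hvu, hu⟩
      rcases hvu.cases_head with rfl | ⟨y, ⟨hvy, hy⟩, hyu⟩
      · exact Or.inl hu
      · exact Or.inr ⟨y, ⟨hy, u, hyu, hu⟩, hvy⟩
  have hright : ∀ x ∈ T, ¬ E (f x) → ∃ r : List V, G.ActivePath Z (f x :: r) ∧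
      (f x :: r).getLast? = some (f n) ∧
      (∀ c ∈ r.head?, f x ∉ Z ∧ G.mark c (f x) ≠ some Mark.arrow) ∧
      ∀ v ∈ r, v = f n ∨ (v ∈ {v ∈ f '' T | ¬ E v} ∧ G.StrictAnc (f x) v) := by
    intro x hx hE
    refine exists_arm hw hacyc (hfin.subset fun v hv => hv.1) ?_ ?_ ?_ ⟨⟨x, hx, rfl⟩, hE⟩
    · rintro _ ⟨⟨i, hi, rfl⟩, -⟩
      exact (hT i hi).2.2.1
    · rintro ⟨⟨i, hi, h⟩, -⟩
      have := hinj' i n (hT i hi).2.1.le le_rfl h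
      exact hnT (this ▸ hi)
    · rintro _ ⟨⟨i, hi, rfl⟩, hEi⟩
      rcases (hT i hi).2.2.2 with h | h | ⟨j, hj, hij⟩
      · exact absurd ⟨f i, Relation.ReflTransGen.refl, h⟩ hEi
      · exact Or.inl h
      · refine Or.inr ⟨f j, ⟨⟨j, hj, rfl⟩, ?_⟩, hij⟩
        rintro ⟨u, hju, hu⟩
        exact hEi ⟨u, Relation.ReflTransGen.head ⟨hij, j, hj, rfl⟩ hju, hu⟩
  let L : ℕ → Prop := fun j => j = 0 ∨ (j ∈ T ∧ E (f j))
  obtain ⟨x, hxL, hxn, hxmax⟩ : ∃ x, L x ∧ x < n ∧ ∀ j, x < j → j < n → ¬ L j := by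
    refine ⟨Nat.findGreatest L (n - 1),
      Nat.findGreatest_spec (P := L) (Nat.zero_le (n - 1)) (Or.inl rfl), ?_, ?_⟩
    · have := Nat.findGreatest_le (P := L) (n - 1)
      omega
    · intro j hj hjn
      exact Nat.findGreatest_is_greatest hj (by omega)
  have hex : ∃ k, x < k ∧ (k = n ∨ k ∈ T) := ⟨n, hxn, Or.inl rfl⟩
  obtain ⟨k, ⟨hxk, hk⟩, hkmin⟩ : ∃ k, (x < k ∧ (k = n ∨ k ∈ T)) ∧
      ∀ j, x < j → j < k → ¬ (j = n ∨ j ∈ T) :=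
    ⟨Nat.find hex, Nat.find_spec hex, fun j hj hjk h => Nat.find_min hex hjk ⟨hj, h⟩⟩
  have hkn : k ≤ n := by
    rcases hk with h | h
    · exact h.le
    · exact (hT k h).2.1.le
  have hkR : k = n ∨ (k ∈ T ∧ ¬ E (f k)) := by
    rcases hk with h | h
    · exact Or.inl h
    · exact Or.inr ⟨h, fun hE => hxmax k hxk (hT k h).2.1 (Or.inr ⟨h, hE⟩)⟩
  obtain ⟨r, hr, hrlast, hrtail, hrmem⟩ : ∃ r : List V, G.ActivePath Z (f x :: r) ∧
      (f x :: r).getLast? = some (f 0) ∧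
      (∀ c ∈ r.head?, f x ∉ Z ∧ G.mark c (f x) ≠ some Mark.arrow) ∧
      ∀ v ∈ r, ∃ j < n, v = f j ∧ L j ∧ j ≠ x := by
    by_cases hx0 : x = 0
    · subst hx0
      exact ⟨[], ⟨by simp, by simp, trivial⟩, by simp, by simp, by simp⟩
    · have hxT : x ∈ T ∧ E (f x) := hxL.resolve_left hx0
      obtain ⟨r, h1, h2, h3, h4⟩ := hleft x hxT.1 hxT.2
      refine ⟨r, h1, h2, h3, fun v hv => ?_⟩
      rcases h4 v hv with rfl | ⟨⟨⟨j, hj, rfl⟩, hE⟩, hanc⟩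
      · exact ⟨0, hn, rfl, Or.inl rfl, fun h => hx0 h.symm⟩
      · exact ⟨j, (hT j hj).2.1, rfl, Or.inr ⟨hj, hE⟩, fun h => hacyc _ (h ▸ hanc)⟩
  obtain ⟨s, hs, hslast, hstail, hsmem⟩ : ∃ s : List V, G.ActivePath Z (f k :: s) ∧
      (f k :: s).getLast? = some (f n) ∧
      (∀ c ∈ s.head?, f k ∉ Z ∧ G.mark c (f k) ≠ some Mark.arrow) ∧
      ∀ v ∈ s, ∃ j ≤ n, v = f j ∧ (j = n ∨ (j ∈ T ∧ ¬ E (f j))) ∧ j ≠ k := by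
    rcases eq_or_ne k n with hkn' | hkn'
    · subst hkn'
      exact ⟨[], ⟨by simp, by simp, trivial⟩, by simp, by simp, by simp⟩
    · have hkT : k ∈ T ∧ ¬ E (f k) := hkR.resolve_left hkn'
      obtain ⟨r, h1, h2, h3, h4⟩ := hright k hkT.1 hkT.2
      refine ⟨r, h1, h2, h3, fun v hv => ?_⟩
      rcases h4 v hv with rfl | ⟨⟨⟨j, hj, rfl⟩, hE⟩, hanc⟩
      · exact ⟨n, le_rfl, rfl, Or.inl rfl, fun h => hkn' h.symm⟩
      · exact ⟨j, (hT j hj).2.1.le, rfl, Or.inr ⟨hj, hE⟩, fun h => hacyc _ (h ▸ hanc)⟩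
  obtain ⟨d, rfl⟩ : ∃ d, k = x + d + 1 := ⟨k - x - 1, by omega⟩
  have hseg := activePath_segment (Z := Z) hinj hadj (d + 1) x (by omega) fun j h1 h2 =>
    hact j (by omega) (by omega) fun h => hkmin j h1 (by omega) (Or.inr h)
  have hseghead : (List.range' x (d + 1 + 1)).map f
      = f x :: (List.range' (x + 1) (d + 1)).map f := by
    rw [List.range'_succ]; simp
  have hseglast : (List.range' x (d + 1 + 1)).map f
      = (List.range' x (d + 1)).map f ++ [f (x + d + 1)] := by
    rw [List.range'_1_concat]; simp [Nat.add_assoc]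
  have hsegmem : ∀ v ∈ (List.range' x (d + 1 + 1)).map f, ∃ j, x ≤ j ∧ j ≤ x + d + 1 ∧ v = f j := by
    intro v hv
    obtain ⟨j, hj, rfl⟩ := List.mem_map.1 hv
    rw [List.mem_range'_1] at hj
    exact ⟨j, by omega, by omega, rfl⟩
  have h1 : G.ActivePath Z (r.reverse ++ (List.range' x (d + 1 + 1)).map f) := by
    rw [hseghead] at hseg hsegmem ⊢
    refine ActivePath.attach hw hr hseg hrtail fun v hv hv' => ?_
    obtain ⟨j, hjn, rfl, hjL, hjx⟩ := hrmem v hv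
    obtain ⟨j', hxj', hj'k, hjj'⟩ := hsegmem _ hv'
    obtain rfl := hinj' j j' hjn.le (by omega) hjj'
    exact hxmax j (by omega) hjn hjL
  have h2 := h1.reverse hw
  rw [hseglast, ← List.append_assoc, List.reverse_append, List.reverse_singleton,
    List.singleton_append] at h2
  have h3 : G.ActivePath Z (s.reverse ++
      f (x + d + 1) :: (r.reverse ++ (List.range' x (d + 1)).map f).reverse) := by
    refine ActivePath.attach hw hs h2 hstail fun v hv hv' => ?_
    obtain ⟨j, hjn, rfl, hjR, hjk⟩ := hsmem v hv
    have hv'' : f j ∈ r ∨ f j ∈ (List.range' x (d + 1 + 1)).map f := by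
      rw [hseglast]
      simp only [List.mem_cons, List.mem_reverse, List.mem_append, List.not_mem_nil,
        or_false] at hv' ⊢
      tauto
    rcases hv'' with hv'' | hv''
    · obtain ⟨j', hj'n, hjj', hjL, -⟩ := hrmem _ hv''
      obtain rfl := hinj' j j' hjn hj'n.le hjj'
      rcases hjL with rfl | hjL
      · rcases hjR with h | h
        · omega
        · exact hzero h.1
      · rcases hjR with h | h
        · omega
        · exact h.2 hjL.2
    · obtain ⟨j', hxj', hj'k, hjj'⟩ := hsegmem _ hv''
      obtain rfl := hinj' j j' hjn (by omega) hjj'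
      rcases eq_or_lt_of_le hxj' with rfl | hlt
      · rcases hjR with h | h
        · omega
        · rcases hxL with rfl | h'
          · exact hzero h.1
          · exact h.2 h'.2
      · exact hkmin j hlt (by omega) (hjR.imp id And.left)
  refine ⟨_, h3.reverse hw, ?_, ?_⟩
  · rw [List.head?_reverse, ← hrlast]
    have : f (x + d + 1) :: (r.reverse ++ (List.range' x (d + 1)).map f).reverse
        = (f (x + d + 1) :: ((List.range' (x + 1) d).map f).reverse) ++ f x :: r := by
      rw [List.range'_succ]; simp
    rw [this, ← List.append_assoc, List.getLast?_append_of_ne_nil _ (List.cons_ne_nil _ _)]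
  · rw [List.getLast?_reverse, ← hslast, List.getLast?_cons, List.head?_append,
      List.head?_reverse]
    cases h : s.getLast? <;> simp

/-! ### Collider sequences -/

/-- The first `m + 1` terms of `f` are successive neighbours whose interior terms are colliders. -/
structure Col (G : MixedGraph V) (m : ℕ) (f : ℕ → V) : Prop where
  adj : ∀ i < m, G.Adj (f i) (f (i + 1))
  collider : ∀ j, 0 < j → j < m → G.Collider (f (j - 1)) (f j) (f (j + 1))

/-- `g` increases on the first `m + 1` indices, from `0` to `n`. -/
structure Extraction (n m : ℕ) (g : ℕ → ℕ) : Prop where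
  step : ∀ i < m, g i < g (i + 1)
  zero : g 0 = 0
  last : g m = n

theorem Extraction.lt {n m : ℕ} {g : ℕ → ℕ} (h : Extraction n m g) {i j : ℕ} (hij : i < j)
    (hj : j ≤ m) : g i < g j := by
  induction j, hij using Nat.le_induction with
  | base => exact h.step i (by omega)
  | succ j _ ih => exact (ih (by omega)).trans (h.step j (by omega))

theorem Extraction.le {n m : ℕ} {g : ℕ → ℕ} (h : Extraction n m g) {j : ℕ} (hj : j ≤ m) :
    g j ≤ n := by
  rcases hj.eq_or_lt with rfl | hlt
  · exact h.last.le
  · exact h.last ▸ (h.lt hlt le_rfl).le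

theorem Extraction.injOn {n m : ℕ} {g : ℕ → ℕ} (h : Extraction n m g) :
    Set.InjOn g (Set.Iic m) := by
  intro i hi j hj hij
  rcases lt_trichotomy i j with hlt | heq | hlt
  · exact absurd hij (h.lt hlt hj).ne
  · exact heq
  · exact absurd hij (h.lt hlt hi).ne'

theorem Extraction.comp {n m l : ℕ} {g g' : ℕ → ℕ} (h : Extraction n m g)
    (h' : Extraction m l g') : Extraction n l (g ∘ g') :=
  ⟨fun i hi => h.lt (h'.step i hi) (h'.le hi), by simp [h'.zero, h.zero],
    by simp [h'.last, h.last]⟩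

/-- No proper subsequence with the same ends is a collider sequence. -/
def NoShortcut (G : MixedGraph V) (n : ℕ) (f : ℕ → V) : Prop :=
  ∀ m g, m < n → Extraction n m g → ¬ G.Col m (f ∘ g)

/-- A collider sequence between non-adjacent vertices without shorter collider subsequence. -/
structure MinCol (G : MixedGraph V) (n : ℕ) (f : ℕ → V) : Prop where
  inj : Set.InjOn f (Set.Iic n)
  nonadj : ¬ G.Adj (f 0) (f n)
  col : G.Col n f
  noShortcut : G.NoShortcut n f

theorem Col.reverse (hw : G.WellFormed) {n : ℕ} {f : ℕ → V} (h : G.Col n f) :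
    G.Col n fun i => f (n - i) := by
  refine ⟨fun i hi => ?_, fun j h1 h2 => ?_⟩
  · have := hw.adj_symm (h.adj (n - (i + 1)) (by omega))
    rwa [show n - (i + 1) + 1 = n - i by omega] at this
  · have := (h.collider (n - j) (by omega) (by omega)).symm
    rwa [show n - j + 1 = n - (j - 1) by omega, show n - j - 1 = n - (j + 1) by omega] at this

theorem NoShortcut.reverse (hw : G.WellFormed) {n : ℕ} {f : ℕ → V} (h : G.NoShortcut n f) :
    G.NoShortcut n fun i => f (n - i) := by
  intro m g hm hg hcol
  refine h m (fun i => n - g (m - i)) hm ⟨fun i hi => ?_, ?_, ?_⟩ (hcol.reverse hw)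
  · have h1 := hg.lt (show m - (i + 1) < m - i by omega) (Nat.sub_le m i)
    have h2 := hg.le (Nat.sub_le m i)
    show n - g (m - i) < n - g (m - (i + 1))
    omega
  · simp [hg.last]
  · simp [hg.zero]

theorem MinCol.reverse (hw : G.WellFormed) {n : ℕ} {f : ℕ → V} (h : G.MinCol n f) :
    G.MinCol n fun i => f (n - i) := by
  refine ⟨fun i hi j hj hij => ?_, fun hadj => h.nonadj ?_, h.col.reverse hw,
    h.noShortcut.reverse hw⟩
  · rw [Set.mem_Iic] at hi hj
    have := h.inj (Set.mem_Iic.2 (Nat.sub_le n i)) (Set.mem_Iic.2 (Nat.sub_le n j)) hij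
    omega
  · simpa using hw.adj_symm hadj

/-- Skipping the terms strictly between `a` and `k`. -/
theorem NoShortcut.false_of_skip {n : ℕ} {f : ℕ → V} (h : G.NoShortcut n f) {a k : ℕ}
    (hadj : ∀ i < n, G.Adj (f i) (f (i + 1))) (hak : a + 1 < k) (hk : k ≤ n)
    (hcol : ∀ j, 0 < j → j < n → j < a ∨ k < j → G.Collider (f (j - 1)) (f j) (f (j + 1)))
    (hadj' : G.Adj (f a) (f k)) (ha : 0 < a → G.Collider (f (a - 1)) (f a) (f k))
    (hk' : k < n → G.Collider (f a) (f k) (f (k + 1))) : False := by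
  refine h (n - (k - a - 1)) (fun j => if j ≤ a then j else j + (k - a - 1)) (by omega)
    ⟨fun i hi => ?_, by simp, ?_⟩ ⟨fun i hi => ?_, fun j h1 h2 => ?_⟩
  · split_ifs <;> omega
  · split_ifs <;> omega
  · rcases lt_trichotomy i a with hia | rfl | hia
    · simp only [Function.comp, if_pos hia.le, if_pos (show i + 1 ≤ a by omega)]
      exact hadj i (by omega)
    · simp only [Function.comp, if_pos le_rfl, if_neg (show ¬ i + 1 ≤ i by omega)]
      rwa [show i + 1 + (k - i - 1) = k by omega]
    · simp only [Function.comp, if_neg (show ¬ i ≤ a by omega),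
        if_neg (show ¬ i + 1 ≤ a by omega)]
      rw [show i + 1 + (k - a - 1) = i + (k - a - 1) + 1 by omega]
      exact hadj _ (by omega)
  · rcases lt_trichotomy j a with hja | rfl | hja
    · simp only [Function.comp, if_pos hja.le, if_pos (show j + 1 ≤ a by omega),
        if_pos (show j - 1 ≤ a by omega)]
      exact hcol j h1 (by omega) (Or.inl hja)
    · simp only [Function.comp, if_pos le_rfl, if_neg (show ¬ j + 1 ≤ j by omega),
        if_pos (show j - 1 ≤ j by omega)]
      rw [show j + 1 + (k - j - 1) = k by omega]
      exact ha h1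
    · rcases eq_or_lt_of_le (Nat.succ_le_of_lt hja) with rfl | hja'
      · simp only [Function.comp, Nat.succ_eq_add_one, Nat.add_sub_cancel, if_pos le_rfl,
          if_neg (show ¬ a + 1 ≤ a by omega), if_neg (show ¬ a + 1 + 1 ≤ a by omega)]
        rw [show a + 1 + (k - a - 1) = k by omega, show a + 1 + 1 + (k - a - 1) = k + 1 by omega]
        exact hk' (by omega)
      · simp only [Function.comp, if_neg (show ¬ j ≤ a by omega),
          if_neg (show ¬ j + 1 ≤ a by omega), if_neg (show ¬ j - 1 ≤ a by omega)]
        have := hcol (j + (k - a - 1)) (by omega) (by omega) (Or.inr (by omega))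
        rwa [show j + (k - a - 1) - 1 = j - 1 + (k - a - 1) by omega,
          show j + (k - a - 1) + 1 = j + 1 + (k - a - 1) by omega] at this

/-- The sequence `f a, f k, f (k + 1), …`. -/
def skipTo (f : ℕ → V) (a k : ℕ) : ℕ → V := fun j => if j = 0 then f a else f (k + j - 1)

theorem skipTo_zero (f : ℕ → V) (a k : ℕ) : skipTo f a k 0 = f a := by simp [skipTo]

theorem skipTo_pos (f : ℕ → V) (a k : ℕ) {j : ℕ} (hj : 0 < j) : skipTo f a k j = f (k + j - 1) := by
  simp [skipTo, hj.ne']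

theorem MinCol.minCol_skipTo {n : ℕ} {f : ℕ → V} (h : G.MinCol n f) {a k : ℕ}
    (hak : a < k) (hkn : k < n) (hadj : ¬ G.Adj (f a) (f n)) (hadj' : G.Adj (f a) (f k))
    (harrow : G.mark (f a) (f k) = some Mark.arrow)
    (hmax : ∀ c, k < c → c < n → G.Adj (f a) (f c) → G.mark (f a) (f c) ≠ some Mark.arrow) :
    G.MinCol (n - k + 1) (skipTo f a k) := by
  have hlast : skipTo f a k (n - k + 1) = f n := by
    rw [skipTo_pos _ _ _ (by omega)]; congr 1; omega
  refine ⟨?_, ?_, ⟨fun i hi => ?_, fun j h1 h2 => ?_⟩, fun m g hm hg hcol => ?_⟩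
  · intro i hi j hj hij
    rw [Set.mem_Iic] at hi hj
    have key : ∀ x y, x ≤ n → y ≤ n → f x = f y → x = y := fun x y hx hy hxy =>
      h.inj (Set.mem_Iic.2 hx) (Set.mem_Iic.2 hy) hxy
    simp only [skipTo] at hij
    split_ifs at hij with hi0 hj0 hj0
    · omega
    · have := key _ _ (by omega) (by omega) hij; omega
    · have := key _ _ (by omega) (by omega) hij; omega
    · have := key _ _ (by omega) (by omega) hij; omega
  · rwa [hlast, skipTo_zero]
  · rcases Nat.eq_zero_or_pos i with rfl | hi0
    · rw [skipTo_zero, skipTo_pos _ _ _ Nat.one_pos]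
      simpa using hadj'
    · rw [skipTo_pos _ _ _ hi0, skipTo_pos _ _ _ (Nat.succ_pos i)]
      have := h.col.adj (k + i - 1) (by omega)
      rwa [show k + i - 1 + 1 = k + (i + 1) - 1 by omega] at this
  · rw [skipTo_pos _ _ _ h1, skipTo_pos _ _ _ (Nat.succ_pos j)]
    have := h.col.collider (k + j - 1) (by omega) (by omega)
    rw [show k + j - 1 + 1 = k + (j + 1) - 1 by omega] at this
    rcases eq_or_lt_of_le (Nat.succ_le_of_lt h1) with rfl | h1'
    · refine ⟨?_, this.2⟩
      simpa [skipTo_zero] using harrow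
    · rw [skipTo_pos _ _ _ (by omega)]
      rwa [show k + j - 1 - 1 = k + (j - 1) - 1 by omega] at this
  · have hm2 : 2 ≤ m := by
      by_contra hlt
      have h0 : m ≠ 0 := by
        rintro rfl
        have := hg.zero.symm.trans hg.last
        omega
      obtain rfl : m = 1 := by omega
      have h01 := hcol.adj 0 (by omega)
      simp only [Function.comp, hg.zero, Nat.zero_add, hg.last, hlast, skipTo_zero] at h01
      exact hadj h01
    have hg1 : 0 < g 1 := hg.zero ▸ hg.lt Nat.one_pos (by omega)
    have hg1' : g 1 < n - k + 1 := hg.last ▸ hg.lt (show 1 < m by omega) le_rfl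
    have hg1'' : g 1 = 1 := by
      by_contra hne
      have h01 := hcol.adj 0 (by omega)
      have h012 := (hcol.collider 1 (by omega) (by omega)).1
      simp only [Function.comp, hg.zero, Nat.zero_add, skipTo_zero, skipTo_pos f a k hg1,
        Nat.sub_self] at h01 h012
      exact hmax (k + g 1 - 1) (by omega) (by omega) h01 h012
    have hgpos : ∀ j, 1 ≤ j → j ≤ m → 0 < g j := fun j h1 h2 =>
      hg.zero ▸ hg.lt (by omega) h2
    have hcut : ∀ j, 1 ≤ j → j ≤ m → (skipTo f a k ∘ g) j = f (k + g j - 1) :=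
      fun j h1 h2 => skipTo_pos f a k (hgpos j h1 h2)
    let H : ℕ → ℕ := fun j => if j ≤ k then j else k + g (j - k + 1) - 1
    have Hle : ∀ j, j ≤ k → H j = j := fun j hj => if_pos hj
    have Hge : ∀ j, k ≤ j → H j = k + g (j - k + 1) - 1 := by
      intro j hj
      rcases hj.eq_or_lt with rfl | hlt
      · simp [H, hg1'']
      · exact if_neg (by omega)
    refine h.noShortcut (k + m - 1) H (by omega) ⟨fun i hi => ?_, ?_, ?_⟩
      ⟨fun i hi => ?_, fun j h1 h2 => ?_⟩
    · rcases lt_or_ge i k with hik | hik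
      · rw [Hle i hik.le, Hle (i + 1) hik]; omega
      · rw [Hge i hik, Hge (i + 1) (by omega)]
        have h1 := hg.lt (show i - k + 1 < i + 1 - k + 1 by omega) (by omega)
        have h2 := hgpos (i - k + 1) (by omega) (by omega)
        omega
    · exact Hle 0 (Nat.zero_le k)
    · rw [Hge _ (by omega), show k + m - 1 - k + 1 = m by omega, hg.last]; omega
    · rcases lt_or_ge i k with hik | hik
      · simp only [Function.comp, Hle i hik.le, Hle (i + 1) hik]
        exact h.col.adj i (by omega)
      · have := hcol.adj (i - k + 1) (by omega)
        rw [hcut _ (by omega) (by omega), hcut _ (by omega) (by omega)] at this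
        simp only [Function.comp, Hge i hik, Hge (i + 1) (show k ≤ i + 1 by omega)]
        rwa [show i + 1 - k + 1 = i - k + 1 + 1 by omega]
    · rcases lt_trichotomy j k with hjk | rfl | hjk
      · simp only [Function.comp, Hle j hjk.le, Hle (j + 1) hjk,
          Hle (j - 1) (show j - 1 ≤ k by omega)]
        exact h.col.collider j h1 (by omega)
      · refine ⟨?_, ?_⟩
        · simp only [Function.comp, Hle j le_rfl, Hle (j - 1) (Nat.sub_le j 1)]
          exact (h.col.collider j h1 hkn).1
        · have := (hcol.collider 1 (by omega) (by omega)).2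
          rw [hcut _ (by omega) (by omega), hcut _ (by omega) (by omega)] at this
          simp only [Function.comp, Hge j le_rfl, Hge (j + 1) (Nat.le_succ j)]
          rwa [show j - j + 1 = 1 by omega, show j + 1 - j + 1 = 1 + 1 by omega]
      · have := hcol.collider (j - k + 1) (by omega) (by omega)
        rw [hcut _ (by omega) (by omega), hcut _ (by omega) (by omega),
          hcut _ (by omega) (by omega)] at this
        simp only [Function.comp, Hge j hjk.le, Hge (j + 1) (show k ≤ j + 1 by omega),
          Hge (j - 1) (show k ≤ j - 1 by omega)]
        rwa [show j + 1 - k + 1 = j - k + 1 + 1 by omega,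
          show j - 1 - k + 1 = j - k + 1 - 1 by omega]

/-! ### Transfer of collider sequences between Markov equivalent graphs -/

/-- The relation between two Markov equivalent ancestral graphs that the transfer of collider
sequences relies on: equal skeletons, and common separating sets closed under parents. -/
structure Twin (A B : MixedGraph V) : Prop where
  wfA : A.WellFormed
  wfB : B.WellFormed
  ncA : A.NoCircles
  ncB : B.NoCircles
  acycA : ∀ a, ¬ A.StrictAnc a a
  acycB : ∀ a, ¬ B.StrictAnc a a
  adj : ∀ a b, A.Adj a b ↔ B.Adj a b
  sep : ∀ a b, a ≠ b → ¬ A.Adj a b → ∃ Z : Set V,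
    (∀ x y, A.DirEdge x y → y ∈ Z → x ∈ Z) ∧ (∀ x y, B.DirEdge x y → y ∈ Z → x ∈ Z) ∧
    (¬ ∃ q, A.ActivePath Z q ∧ q.head? = some a ∧ q.getLast? = some b) ∧
    ¬ ∃ q, B.ActivePath Z q ∧ q.head? = some a ∧ q.getLast? = some b

theorem Twin.symm {A B : MixedGraph V} (h : Twin A B) : Twin B A where
  wfA := h.wfB
  wfB := h.wfA
  ncA := h.ncB
  ncB := h.ncA
  acycA := h.acycB
  acycB := h.acycA
  adj a b := (h.adj a b).symm
  sep a b hab hadj := by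
    obtain ⟨Z, h1, h2, h3, h4⟩ := h.sep a b hab fun h' => hadj ((h.adj a b).1 h')
    exact ⟨Z, h2, h1, h4, h3⟩

variable {A B : MixedGraph V} {n : ℕ} {f : ℕ → V}

theorem Twin.noShortcut (hT : Twin A B) (hA : A.MinCol n f)
    (ih : ∀ m < n, ∀ g, B.MinCol m g → A.Col m g) : B.NoShortcut n f := by
  intro m
  induction m using Nat.strong_induction_on with
  | _ m IH =>
    intro g hm hg hcol
    refine hA.noShortcut m g hm hg (ih m hm (f ∘ g) ⟨?_, ?_, hcol, fun l g' hl hgl => ?_⟩)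
    · intro i hi j hj hij
      exact hg.injOn hi hj
        (hA.inj (Set.mem_Iic.2 (hg.le hi)) (Set.mem_Iic.2 (hg.le hj)) hij)
    · simp only [Function.comp, hg.zero, hg.last]
      exact fun h => hA.nonadj ((hT.adj _ _).2 h)
    · exact IH l hl (g ∘ g') (hl.trans hm) (hg.comp hgl)

/-- A vertex before a non-collider of `B` has a tail towards the end or a child beyond. -/
theorem Twin.exists_child_right (hT : Twin A B) (hA : A.MinCol n f)
    (ihA : ∀ m < n, ∀ g, A.MinCol m g → B.Col m g) (hB : B.NoShortcut n f) {a i : ℕ}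
    (ha : 0 < a) (hai : a < i) (hin : i < n)
    (hi : ¬ B.Collider (f (i - 1)) (f i) (f (i + 1))) :
    (A.Adj (f a) (f n) ∧ A.mark (f n) (f a) ≠ some Mark.arrow ∧
      ((∀ j, 0 < j → j ≤ a → B.Collider (f (j - 1)) (f j) (f (j + 1))) →
        B.mark (f n) (f a) ≠ some Mark.arrow)) ∨
    ∃ k, i ≤ k ∧ k < n ∧ A.DirEdge (f a) (f k) ∧
      (k = i → B.Collider (f a) (f i) (f (i + 1))) ∧
      ((∀ j, 0 < j → j ≤ a → B.Collider (f (j - 1)) (f j) (f (j + 1))) →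
        B.DirEdge (f a) (f k)) := by
  have hadjB : ∀ i < n, B.Adj (f i) (f (i + 1)) := fun i hi => (hT.adj _ _).1 (hA.col.adj i hi)
  by_cases hadj : A.Adj (f a) (f n)
  · refine Or.inl ⟨hadj, fun h => ?_, fun hcol h => ?_⟩
    · exact hA.noShortcut.false_of_skip hA.col.adj (a := a) (k := n) (by omega) le_rfl
        (fun j h1 h2 _ => hA.col.collider j h1 h2) hadj
        (fun h0 => ⟨(hA.col.collider a h0 (by omega)).1, h⟩) fun h => absurd h (lt_irrefl n)
    · exact hB.false_of_skip hadjB (a := a) (k := n) (by omega) le_rfl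
        (fun j h1 h2 h3 => hcol j h1 (by omega)) ((hT.adj _ _).1 hadj)
        (fun h0 => ⟨(hcol a h0 le_rfl).1, h⟩) fun h => absurd h (lt_irrefl n)
  · right
    let Q : ℕ → Prop := fun c => A.Adj (f a) (f c) ∧ A.mark (f a) (f c) = some Mark.arrow ∧ a < c
    have hQ : Q (a + 1) := by
      refine ⟨hA.col.adj a (by omega), ?_, Nat.lt_succ_self a⟩
      simpa using (hA.col.collider (a + 1) (by omega) (by omega)).1
    obtain ⟨k, ⟨hkadj, hkarrow, hak⟩, hkn, hkmax⟩ :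
        ∃ k, Q k ∧ k < n ∧ ∀ c, k < c → c < n → ¬ Q c := by
      refine ⟨Nat.findGreatest Q (n - 1),
        Nat.findGreatest_spec (P := Q) (show a + 1 ≤ n - 1 by omega) hQ, ?_, ?_⟩
      · have := Nat.findGreatest_le (P := Q) (n - 1)
        omega
      · intro j hj hjn
        exact Nat.findGreatest_is_greatest hj (by omega)
    have hcut := ihA _ (by omega) _ (hA.minCol_skipTo hak hkn hadj hkadj hkarrow
      fun c h1 h2 h3 h4 => hkmax c h1 h2 ⟨h3, h4, hak.trans h1⟩)
    have hcutk : B.Collider (f a) (f k) (f (k + 1)) := by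
      have := hcut.collider 1 (by omega) (by omega)
      rwa [Nat.sub_self, skipTo_zero, skipTo_pos _ _ _ Nat.one_pos,
        skipTo_pos _ _ _ (show 0 < 1 + 1 by omega), Nat.add_sub_cancel] at this
    have hcutlt : ∀ j, k < j → j < n → B.Collider (f (j - 1)) (f j) (f (j + 1)) := by
      intro j h1 h2
      have := hcut.collider (j - k + 1) (by omega) (by omega)
      rwa [skipTo_pos _ _ _ (by omega), skipTo_pos _ _ _ (by omega), skipTo_pos _ _ _ (by omega),
        show k + (j - k + 1 - 1) - 1 = j - 1 by omega, show k + (j - k + 1) - 1 = j by omega,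
        show k + (j - k + 1 + 1) - 1 = j + 1 by omega] at this
    have hik : i ≤ k := by
      by_contra hlt
      exact hi (hcutlt i (by omega) hin)
    have hak' : a + 1 < k := by
      by_contra hlt
      obtain rfl : i = k := by omega
      obtain rfl : a = i - 1 := by omega
      exact hi hcutk
    refine ⟨k, hik, hkn, dirEdge_of_not_arrow hT.wfA hT.ncA hkarrow fun h => ?_, ?_,
      fun hcol => dirEdge_of_not_arrow hT.wfB hT.ncB hcutk.1 fun h => ?_⟩
    · exact hA.noShortcut.false_of_skip hA.col.adj hak' hkn.le
        (fun j h1 h2 _ => hA.col.collider j h1 h2) hkadj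
        (fun h0 => ⟨(hA.col.collider a h0 (by omega)).1, h⟩)
        fun h => ⟨hkarrow, (hA.col.collider k (by omega) h).2⟩
    · rintro rfl
      exact hcutk
    · exact hB.false_of_skip hadjB hak' hkn.le
        (fun j h1 h2 h3 => h3.elim (fun h => hcol j h1 h.le) fun h => hcutlt j h h2)
        ((hT.adj _ _).1 hkadj) (fun h0 => ⟨(hcol a h0 le_rfl).1, h⟩) fun _ => hcutk

/-- A vertex after a non-collider of `B` has a tail towards the start or a child before. -/
theorem Twin.exists_child_left (hT : Twin A B) (hA : A.MinCol n f)
    (ihA : ∀ m < n, ∀ g, A.MinCol m g → B.Col m g) (hB : B.NoShortcut n f) {a i : ℕ}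
    (hi0 : 0 < i) (hia : i < a) (han : a < n)
    (hi : ¬ B.Collider (f (i - 1)) (f i) (f (i + 1))) :
    (A.Adj (f a) (f 0) ∧ A.mark (f 0) (f a) ≠ some Mark.arrow ∧
      ((∀ j, a ≤ j → j < n → B.Collider (f (j - 1)) (f j) (f (j + 1))) →
        B.mark (f 0) (f a) ≠ some Mark.arrow)) ∨
    ∃ k, 0 < k ∧ k ≤ i ∧ A.DirEdge (f a) (f k) ∧
      (k = i → B.Collider (f (i - 1)) (f i) (f a)) ∧
      ((∀ j, a ≤ j → j < n → B.Collider (f (j - 1)) (f j) (f (j + 1))) →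
        B.DirEdge (f a) (f k)) := by
  have hi' : ¬ B.Collider (f (n - (n - i - 1))) (f (n - (n - i))) (f (n - (n - i + 1))) := by
    rw [show n - (n - i - 1) = i + 1 by omega, show n - (n - i) = i by omega,
      show n - (n - i + 1) = i - 1 by omega]
    exact fun h => hi h.symm
  have hall : (∀ j, a ≤ j → j < n → B.Collider (f (j - 1)) (f j) (f (j + 1))) →
      ∀ j, 0 < j → j ≤ n - a →
        B.Collider (f (n - (j - 1))) (f (n - j)) (f (n - (j + 1))) := by
    intro h j h1 h2
    have := (h (n - j) (by omega) (by omega)).symm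
    rwa [show n - j + 1 = n - (j - 1) by omega, show n - j - 1 = n - (j + 1) by omega] at this
  rcases hT.exists_child_right (hA.reverse hT.wfA) ihA (hB.reverse hT.wfB) (a := n - a)
    (i := n - i) (by omega) (by omega) (by omega) hi' with ⟨h1, h2, h3⟩ | ⟨k, h1, h2, h3, h4, h5⟩
  · simp only [Nat.sub_self, show n - (n - a) = a by omega] at h1 h2 h3
    exact Or.inl ⟨h1, h2, fun h => h3 (hall h)⟩
  · simp only [show n - (n - a) = a by omega] at h3 h4 h5
    refine Or.inr ⟨n - k, by omega, by omega, h3, fun hk => ?_, fun h => h5 (hall h)⟩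
    have := (h4 (by omega)).symm
    rwa [show n - (n - i + 1) = i - 1 by omega, show n - (n - i) = i by omega] at this

/-- Minimal collider sequences are collider sequences in every Markov equivalent graph. -/
theorem Twin.col (hT : Twin A B) (hA : A.MinCol n f) : B.Col n f := by
  induction n using Nat.strong_induction_on generalizing A B f with
  | _ n IH =>
    have ihA : ∀ m < n, ∀ g, A.MinCol m g → B.Col m g := fun m hm g hg => IH m hm hT hg
    have hB : B.NoShortcut n f := hT.noShortcut hA fun m hm g hg => IH m hm hT.symm hg
    have hadjB : ∀ i < n, B.Adj (f i) (f (i + 1)) := fun i hi => (hT.adj _ _).1 (hA.col.adj i hi)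
    refine ⟨hadjB, ?_⟩
    by_contra! hnon
    obtain ⟨i₀, hi₀, hi₀n, hi₀c⟩ := hnon
    have hn : 0 < n := hi₀.trans hi₀n
    have hne : f 0 ≠ f n := fun h =>
      hn.ne (hA.inj (Set.mem_Iic.2 hn.le) (Set.mem_Iic.2 le_rfl) h)
    obtain ⟨Z, hZA, hZB, hsepA, hsepB⟩ := hT.sep _ _ hne hA.nonadj
    let U : Set ℕ := {x | 0 < x ∧ x < n ∧ f x ∉ Z}
    obtain ⟨i, hiU, hion⟩ : ∃ i ∈ U, ∀ j, 0 < j → j < n → j ≠ i →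
        B.Collider (f (j - 1)) (f j) (f (j + 1)) := by
      by_contra! hcon
      refine hsepA (exists_activePath (T := U) hT.wfA hT.acycA hn hA.inj hA.col.adj ?_ ?_)
      · intro x hx
        obtain ⟨hx0, hxn, hxZ⟩ := id hx
        refine ⟨hx0, hxn, hxZ, ?_⟩
        obtain ⟨j, hj0, hjn, hjx, hj⟩ := hcon x hx
        rcases hjx.lt_or_gt with hlt | hlt
        · rcases hT.exists_child_left hA ihA hB hj0 hlt hxn hj with
            h | ⟨k, hk0, hkj, hk, -, -⟩
          · exact Or.inl ⟨h.1, h.2.1⟩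
          · exact Or.inr (Or.inr ⟨k, ⟨hk0, by omega, fun h => hxZ (hZA _ _ hk h)⟩, hk⟩)
        · rcases hT.exists_child_right hA ihA hB hx0 hlt hjn hj with
            h | ⟨k, hjk, hkn, hk, -, -⟩
          · exact Or.inr (Or.inl ⟨h.1, h.2.1⟩)
          · exact Or.inr (Or.inr ⟨k, ⟨by omega, hkn, fun h => hxZ (hZA _ _ hk h)⟩, hk⟩)
      · intro j h1 h2 h3
        exact iff_of_true (hA.col.collider j h1 h2) (not_not.1 fun h => h3 ⟨h1, h2, h⟩)
    obtain ⟨hi0, hin, hiZ⟩ := id hiU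
    have hic : ¬ B.Collider (f (i - 1)) (f i) (f (i + 1)) := by
      rcases eq_or_ne i₀ i with rfl | h
      · exact hi₀c
      · exact absurd (hion i₀ hi₀ hi₀n h) hi₀c
    have hout : ∀ x ∈ U, x ≠ i →
        (B.Adj (f x) (f 0) ∧ B.mark (f 0) (f x) ≠ some Mark.arrow) ∨
        (B.Adj (f x) (f n) ∧ B.mark (f n) (f x) ≠ some Mark.arrow) ∨
        ∃ k ∈ U, B.DirEdge (f x) (f k) ∧ (k = i → ∃ y ∈ U, B.DirEdge (f i) (f y)) := by
      rintro x ⟨hx0, hxn, hxZ⟩ hxi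
      rcases hxi.lt_or_gt with hlt | hlt
      · have hall : ∀ j, 0 < j → j ≤ x → B.Collider (f (j - 1)) (f j) (f (j + 1)) :=
          fun j h1 h2 => hion j h1 (by omega) (by omega)
        rcases hT.exists_child_right hA ihA hB hx0 hlt hin hic with
          h | ⟨k, hik, hkn, -, hki, hk⟩
        · exact Or.inr (Or.inl ⟨(hT.adj _ _).1 h.1, h.2.2 hall⟩)
        · refine Or.inr (Or.inr ⟨k, ⟨by omega, hkn, fun h => hxZ (hZB _ _ (hk hall) h)⟩,
            hk hall, fun hki' => ?_⟩)
          have h1 := hki hki'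
          have hxi' : x ≠ i - 1 := fun h => hic (h ▸ h1)
          have h2 := (hion (i - 1) (by omega) (by omega) (by omega)).2
          rw [Nat.sub_add_cancel (by omega)] at h2
          have h3 : B.DirEdge (f i) (f (i - 1)) :=
            dirEdge_of_not_arrow hT.wfB hT.ncB h2 fun h => hic ⟨h, h1.2⟩
          exact ⟨i - 1, ⟨by omega, by omega, fun h => hiZ (hZB _ _ h3 h)⟩, h3⟩
      · have hall : ∀ j, x ≤ j → j < n → B.Collider (f (j - 1)) (f j) (f (j + 1)) :=
          fun j h1 h2 => hion j (by omega) h2 (by omega)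
        rcases hT.exists_child_left hA ihA hB hi0 hlt hxn hic with
          h | ⟨k, hk0, hki, -, hki', hk⟩
        · exact Or.inl ⟨(hT.adj _ _).1 h.1, h.2.2 hall⟩
        · refine Or.inr (Or.inr ⟨k, ⟨hk0, by omega, fun h => hxZ (hZB _ _ (hk hall) h)⟩,
            hk hall, fun hki'' => ?_⟩)
          have h1 := hki' hki''
          have hxi' : x ≠ i + 1 := fun h => hic (h ▸ h1)
          have h2 := (hion (i + 1) (by omega) (by omega) (by omega)).1
          rw [Nat.add_sub_cancel] at h2
          have h3 : B.DirEdge (f i) (f (i + 1)) :=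
            dirEdge_of_not_arrow hT.wfB hT.ncB h2 fun h => hic ⟨h1.1, h⟩
          exact ⟨i + 1, ⟨by omega, by omega, fun h => hiZ (hZB _ _ h3 h)⟩, h3⟩
    by_cases hchild : ∃ y ∈ U, B.DirEdge (f i) (f y)
    · refine hsepB (exists_activePath (T := U) hT.wfB hT.acycB hn hA.inj hadjB ?_ ?_)
      · intro x hx
        refine ⟨hx.1, hx.2.1, hx.2.2, ?_⟩
        rcases eq_or_ne x i with rfl | hxi
        · exact Or.inr (Or.inr hchild)
        · exact (hout x hx hxi).imp_right fun h => h.imp_right fun ⟨k, h1, h2, _⟩ => ⟨k, h1, h2⟩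
      · intro j h1 h2 h3
        refine iff_of_true (hion j h1 h2 ?_) (not_not.1 fun h => h3 ⟨h1, h2, h⟩)
        rintro rfl
        exact h3 hiU
    · refine hsepB (exists_activePath (T := U \ {i}) hT.wfB hT.acycB hn hA.inj hadjB ?_ ?_)
      · rintro x ⟨hx, hxi⟩
        refine ⟨hx.1, hx.2.1, hx.2.2, (hout x hx hxi).imp_right fun h => h.imp_right ?_⟩
        rintro ⟨k, h1, h2, h3⟩
        exact ⟨k, ⟨h1, fun h => hchild (h3 h)⟩, h2⟩
      · intro j h1 h2 h3
        rcases eq_or_ne j i with rfl | hji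
        · exact iff_of_false hic hiZ
        · exact iff_of_true (hion j h1 h2 hji) (not_not.1 fun h => h3 ⟨⟨h1, h2, h⟩, hji⟩)

/-! ### Parent-closed separating sets -/

/-- The ancestors of the elements of `Z`. -/
def ancSet (G : MixedGraph V) (Z : Set V) : Set V := {v | ∃ z ∈ Z, G.Anc v z}

theorem subset_ancSet (G : MixedGraph V) (Z : Set V) : Z ⊆ G.ancSet Z := fun z hz =>
  ⟨z, hz, Relation.ReflTransGen.refl⟩

theorem MSep.ancSet {X Y : V} (h : G.MSep X Y Z) : G.MSep X Y (G.ancSet Z) := by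
  rintro ⟨p, hp, hact⟩
  refine h ⟨p, hp, fun a b c habc => ⟨fun hcol => ?_, fun hcol hb => ?_⟩⟩
  · obtain ⟨w, ⟨z, hz, hwz⟩, hbw⟩ := (hact a b c habc).1 hcol
    exact ⟨z, hz, hbw.trans hwz⟩
  · exact (hact a b c habc).2 hcol (G.subset_ancSet Z hb)

theorem not_mSep_of_adj (hw : G.WellFormed) {X Y : V} (h : G.Adj X Y) (Z : Set V) :
    ¬ G.MSep X Y Z := by
  refine not_not.2 ⟨[X, Y], ⟨⟨le_rfl, ?_, ?_⟩, rfl, rfl⟩, ?_⟩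
  · simpa using hw.ne_of_adj h
  · exact List.isChain_pair.2 h
  · rintro a b c ⟨i, -, -, h⟩
    simp at h

theorem MarkovEq.symm {M M' : MixedGraph V} (h : MarkovEq M M') : MarkovEq M' M :=
  fun X Y Z => (h X Y Z).symm

theorem MarkovEq.adj {M M' : MixedGraph V} (hM : M.IsMAG) (hM' : M'.IsMAG) (h : MarkovEq M M')
    {a b : V} (hab : M.Adj a b) : M'.Adj a b := by
  by_contra hn
  obtain ⟨Z, -, -, hZ⟩ := hM'.2.2.2 a b (hM.1.ne_of_adj hab) hn
  exact not_mSep_of_adj hM.1 hab Z ((h a b Z).2 hZ)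

/-- An active path for an increasing union is connecting for some member of the family. -/
theorem ActivePath.exists_mConnPath {W : ℕ → Set V} (hW : Monotone W) {q : List V} {a b : V}
    (hq : G.ActivePath (⋃ k, W k) q) (ha : q.head? = some a) (hb : q.getLast? = some b)
    (hab : a ≠ b) : ∃ k, G.MConnPath (W k) a b q := by
  have hK : ∀ l : List V, ∃ K, ∀ v ∈ l, v ∈ ⋃ k, W k → v ∈ W K := by
    intro l
    induction l with
    | nil => exact ⟨0, by simp⟩
    | cons x l ih =>
      obtain ⟨K, hK⟩ := ih
      by_cases hx : x ∈ ⋃ k, W k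
      · obtain ⟨k, hk⟩ := Set.mem_iUnion.1 hx
        refine ⟨max k K, List.forall_mem_cons.2 ⟨fun _ => hW (le_max_left k K) hk, fun v hv h =>
          hW (le_max_right k K) (hK v hv h)⟩⟩
      · exact ⟨K, List.forall_mem_cons.2 ⟨fun h => absurd h hx, hK⟩⟩
  obtain ⟨K, hK⟩ := hK q
  refine ⟨K, ⟨⟨?_, hq.nodup, hq.chain⟩, ha, hb⟩, fun x y z hxyz => ⟨fun hcol => ?_, ?_⟩⟩
  · rcases q with _ | ⟨x, _ | ⟨y, q⟩⟩
    · simp at ha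
    · simp only [List.head?_cons, List.getLast?_singleton, Option.some.injEq] at ha hb
      exact absurd (ha.symm.trans hb) hab
    · simp
  · obtain ⟨i, -, hy, -⟩ := id hxyz
    exact ⟨y, hK y (List.mem_of_getElem? hy) ((hq.active.triple _ _ _ _ hxyz).1 hcol),
      Relation.ReflTransGen.refl⟩
  · exact fun hcol hy => hcol ((hq.active.triple _ _ _ _ hxyz).2 (Set.mem_iUnion.2 ⟨K, hy⟩))

/-- Markov equivalent maximal ancestral graphs are twins. -/
theorem MarkovEq.twin {M M' : MixedGraph V} (hM : M.IsMAG) (hM' : M'.IsMAG)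
    (h : MarkovEq M M') : Twin M M' where
  wfA := hM.1
  wfB := hM'.1
  ncA := hM.2.1
  ncB := hM'.2.1
  acycA := hM.2.2.1.1
  acycB := hM'.2.2.1.1
  adj a b := ⟨h.adj hM hM', h.symm.adj hM' hM⟩
  sep a b hab hadj := by
    obtain ⟨Z₀, -, -, hZ₀⟩ := hM.2.2.2 a b hab hadj
    let S : Set V → Set V := fun Z => M'.ancSet (M.ancSet Z)
    let W : ℕ → Set V := fun k => S^[k] Z₀
    have hWsucc : ∀ k, W (k + 1) = S (W k) := fun k => Function.iterate_succ_apply' S k Z₀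
    have hsep : ∀ k, M.MSep a b (W k) := by
      intro k
      induction k with
      | zero => exact hZ₀
      | succ k ih =>
        rw [hWsucc]
        exact (h a b _).2 ((h a b _).1 ih.ancSet).ancSet
    have hmono : Monotone W := monotone_nat_of_le_succ fun k => by
      rw [hWsucc]
      exact (M.subset_ancSet _).trans (M'.subset_ancSet _)
    refine ⟨⋃ k, W k, fun x y hxy hy => ?_, fun x y hxy hy => ?_, ?_, ?_⟩
    · obtain ⟨k, hk⟩ := Set.mem_iUnion.1 hy
      refine Set.mem_iUnion.2 ⟨k + 1, ?_⟩
      rw [hWsucc]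
      exact M'.subset_ancSet _ ⟨y, hk, Relation.ReflTransGen.single hxy⟩
    · obtain ⟨k, hk⟩ := Set.mem_iUnion.1 hy
      refine Set.mem_iUnion.2 ⟨k + 1, ?_⟩
      rw [hWsucc]
      exact ⟨y, M.subset_ancSet _ hk, Relation.ReflTransGen.single hxy⟩
    · rintro ⟨q, hq, ha, hb⟩
      obtain ⟨k, hk⟩ := hq.exists_mConnPath hmono ha hb hab
      exact hsep k ⟨q, hk⟩
    · rintro ⟨q, hq, ha, hb⟩
      obtain ⟨k, hk⟩ := hq.exists_mConnPath hmono ha hb hab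
      exact (h a b _).1 (hsep k) ⟨q, hk⟩

/-! ### Lists and sequences -/

theorem Extraction.sublist_range {n m : ℕ} {g : ℕ → ℕ} (h : Extraction n m g) :
    ((List.range (m + 1)).map g).Sublist (List.range (n + 1)) := by
  have hpw : ((List.range (m + 1)).map g).Pairwise (· < ·) := by
    refine List.pairwise_map.2 (List.pairwise_lt_range.imp_of_mem fun _ hb hab => h.lt hab ?_)
    rw [List.mem_range] at hb
    omega
  refine List.sublist_of_subperm_of_pairwise (List.subperm_of_subset (hpw.imp fun h => h.ne) ?_)
    hpw List.pairwise_lt_range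
  intro v hv
  obtain ⟨j, hj, rfl⟩ := List.mem_map.1 hv
  rw [List.mem_range] at hj ⊢
  have := h.le (show j ≤ m by omega)
  omega

theorem Col.allColliders {m : ℕ} {f : ℕ → V} (h : G.Col m f) :
    G.AllColliders ((List.range (m + 1)).map f) := by
  rintro a b c ⟨i, h1, h2, h3⟩
  simp only [List.getElem?_map, Option.map_eq_some_iff, List.getElem?_eq_some_iff,
    List.getElem_range, List.length_range] at h1 h2 h3
  obtain ⟨_, ⟨-, rfl⟩, rfl⟩ := h1
  obtain ⟨_, ⟨-, rfl⟩, rfl⟩ := h2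
  obtain ⟨_, ⟨h3, rfl⟩, rfl⟩ := h3
  exact h.collider (i + 1) (by omega) (by omega)

theorem Col.isChain {m : ℕ} {f : ℕ → V} (h : G.Col m f) :
    ((List.range (m + 1)).map f).IsChain G.Adj := by
  rw [List.isChain_iff_getElem]
  intro i hi
  simpa using h.adj i (by simpa using hi)

/-- A shortest collider path, read as a sequence of vertices. -/
theorem exists_minCol {X Y : V} (hadj : ¬ G.Adj X Y) {p : List V} (hp : G.IsPathBetween X Y p)
    (hcol : G.AllColliders p)
    (hshort : ∀ q : List V, q.Sublist p → G.IsPathBetween X Y q → G.AllColliders q →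
      p.length ≤ q.length) :
    ∃ n f, p = (List.range (n + 1)).map f ∧ G.MinCol n f := by
  obtain ⟨⟨hlen, hnodup, hchain⟩, hhead, hlast⟩ := hp
  obtain ⟨n, hn⟩ : ∃ n, p.length = n + 1 := ⟨p.length - 1, by omega⟩
  let f : ℕ → V := fun i => p.getD i X
  have hf : ∀ i ≤ n, p[i]? = some (f i) := fun i hi => by
    simp [f, List.getElem?_eq_getElem (show i < p.length by omega)]
  have hpf : p = (List.range (n + 1)).map f := by
    refine List.ext_getElem? fun i => ?_
    rcases lt_or_ge i (n + 1) with hi | hi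
    · simp [hf i (by omega), List.getElem?_range hi]
    · rw [List.getElem?_eq_none (by omega), List.getElem?_eq_none (by simpa using hi)]
  have h0 : f 0 = X := by
    rw [List.head?_eq_getElem?, hf 0 (Nat.zero_le n)] at hhead
    exact Option.some.inj hhead
  have hfn : f n = Y := by
    rw [List.getLast?_eq_getElem?, hn, Nat.add_sub_cancel, hf n le_rfl] at hlast
    exact Option.some.inj hlast
  refine ⟨n, f, hpf, ⟨fun i hi j hj hij => ?_, by rwa [h0, hfn], ⟨fun i hi => ?_,
    fun j h1 h2 => ?_⟩, fun m g hm hg hgcol => ?_⟩⟩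
  · rw [Set.mem_Iic] at hi hj
    refine (List.getElem?_inj (show i < p.length by omega) hnodup).1 ?_
    rw [hf i hi, hf j hj, hij]
  · have h1 := List.isChain_iff_getElem.1 hchain i (by omega)
    have h2 := hf i hi.le
    have h3 := hf (i + 1) hi
    rw [List.getElem?_eq_getElem (by omega), Option.some.injEq] at h2 h3
    rwa [h2, h3] at h1
  · refine hcol _ _ _ ⟨j - 1, hf _ (by omega), ?_, ?_⟩
    · rw [Nat.sub_add_cancel h1, hf j h2.le]
    · rw [show j - 1 + 2 = j + 1 by omega, hf (j + 1) h2]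
  · have hsub : ((List.range (m + 1)).map (f ∘ g)).Sublist p := by
      rw [hpf, ← List.map_map]
      exact hg.sublist_range.map f
    have hm0 : m ≠ 0 := by
      rintro rfl
      have := hg.zero.symm.trans hg.last
      omega
    have := hshort _ hsub ⟨⟨by simp; omega, hsub.nodup hnodup, hgcol.isChain⟩, ?_, ?_⟩
      hgcol.allColliders
    · simp [hn] at this
      omega
    · simp [List.head?_range, hg.zero, h0]
    · simp [List.getLast?_range, hg.last, hfn]

end MixedGraph

/-- **Lemma II.** If `X` and `Y` are non-adjacent in the MAG `M` and `p`
is a shortest collider path between `X` and `Y` over any subsequence of its non-endpoint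
nodes, then `p` is of definite status in the PAG `P`. -/
theorem shortest_collider_path_definite {V : Type} (M : MixedGraph V) (hM : M.IsMAG)
    (P : MixedGraph V) (hP : IsPAGof P M)
    (X Y : V) (hadj : ¬ M.Adj X Y)
    (p : List V) (hp : M.IsPathBetween X Y p) (hcol : M.AllColliders p)
    (hshort : ∀ q : List V, q.Sublist p → M.IsPathBetween X Y q → M.AllColliders q →
      p.length ≤ q.length) :
    P.DefStatusPath p := by
  obtain ⟨n, f, rfl, hmin⟩ := MixedGraph.exists_minCol hadj hp hcol hshort
  intro a b c habc
  have hM' : ∀ M' : MixedGraph V, M'.IsMAG → MixedGraph.MarkovEq M M' → M'.Collider a b c :=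
    fun M' hM' h => ((h.twin hM hM').col hmin).allColliders a b c habc
  have hself := hcol a b c habc
  have hab : P.Adj a b := (hP.1 a b).2 (by simp [MixedGraph.Adj, hself.1])
  have hcb : P.Adj c b := (hP.1 c b).2 (by simp [MixedGraph.Adj, hself.2])
  exact Or.inl ⟨(hP.2 a b hab).1.2 fun M' h h' => (hM' M' h h').1,
    (hP.2 c b hcb).1.2 fun M' h h' => (hM' M' h h').2⟩

end CG
end
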